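/- There exist an event Ω₁ ∈ 𝓕 of full probability and a function m̄ : (H̄*, ∞) × ℝ^d → ℝ, written m̄_μ(y), such that for every ω ∈ Ω₁, every μ > H̄* and all x, y ∈ ℝ^d: lim_{t→∞} t^{-1} m_μ(ty, tx, ω) = m̄_μ(y − x). Moreover, for each μ > H̄*, m̄_μ is Lipschitz, positively homogeneous (m̄_μ(sy) = s·m̄_μ(y) for all s ≥ 0) and convex, and for each y ≠ 0 the map μ ↦ m̄_μ(y) is strictly increasing on (H̄*, ∞). -/

import Mathlib

open MeasureTheory Filter Topology Bornology
open scoped RealInnerProductSpace NNReal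

noncomputable section

/-- Euclidean space ℝ^d. -/
abbrev Ed (d : ℕ) := EuclideanSpace ℝ (Fin d)

/-- The set 𝓛 of globally Lipschitz real-valued functions on ℝ^d. -/
def LipFuns (d : ℕ) : Set (Ed d → ℝ) := {w | ∃ C : ℝ≥0, LipschitzWith C w}

/-- SL⁺ : Lipschitz functions sublinear from below, i.e. liminf_{|y|→∞} w(y)/|y| ≥ 0. -/
def SLplus (d : ℕ) : Set (Ed d → ℝ) :=
  {w | w ∈ LipFuns d ∧ ∀ ε : ℝ, 0 < ε → ∃ R : ℝ, ∀ y : Ed d, R ≤ ‖y‖ → -ε ≤ w y / ‖y‖}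

/-- SL⁻ : Lipschitz functions sublinear from above, i.e. limsup_{|y|→∞} w(y)/|y| ≤ 0. -/
def SLminus (d : ℕ) : Set (Ed d → ℝ) :=
  {w | w ∈ LipFuns d ∧ ∀ ε : ℝ, 0 < ε → ∃ R : ℝ, ∀ y : Ed d, R ≤ ‖y‖ → w y / ‖y‖ ≤ ε}

/-- 𝓢 : Lipschitz functions strictly sublinear at infinity. -/
def Scal (d : ℕ) : Set (Ed d → ℝ) := SLplus d ∩ SLminus d

/-- H̄₊(p) = inf_{w ∈ SL⁺} esssup_y H(p + Dw(y), y). -/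
def HbarPlus (d : ℕ) (H : Ed d → Ed d → ℝ) (p : Ed d) : ℝ :=
  sInf {t | ∃ w ∈ SLplus d, t = essSup (fun y => H (p + gradient w y) y) volume}

/-- H̄₋(p) = inf_{w ∈ SL⁻} esssup_y H(p + Dw(y), y). -/
def HbarMinus (d : ℕ) (H : Ed d → Ed d → ℝ) (p : Ed d) : ℝ :=
  sInf {t | ∃ w ∈ SLminus d, t = essSup (fun y => H (p + gradient w y) y) volume}

/-- Ĥ(p) = inf_{w ∈ 𝓢} esssup_y H(p + Dw(y), y). -/
def Hhat (d : ℕ) (H : Ed d → Ed d → ℝ) (p : Ed d) : ℝ :=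
  sInf {t | ∃ w ∈ Scal d, t = essSup (fun y => H (p + gradient w y) y) volume}

/-- H̄* = inf_{w ∈ 𝓛} esssup_y H(Dw(y), y). -/
def Hstar (d : ℕ) (H : Ed d → Ed d → ℝ) : ℝ :=
  sInf {t | ∃ w ∈ LipFuns d, t = essSup (fun y => H (gradient w y) y) volume}

/-- m_μ(y,x) = sup { w(y) − w(x) : w ∈ 𝓛, H(Dw,z) ≤ μ a.e. }. -/
def mMu (d : ℕ) (H : Ed d → Ed d → ℝ) (μ : ℝ) (y x : Ed d) : ℝ :=
  sSup {t | ∃ w ∈ LipFuns d, (∀ᵐ z ∂volume, H (gradient w z) z ≤ μ) ∧ t = w y - w x}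

/-- Viscosity subsolution of F(Du, y) ≤ μ in U. -/
def ViscSub (d : ℕ) (F : Ed d → Ed d → ℝ) (μ : ℝ) (U : Set (Ed d)) (u : Ed d → ℝ) : Prop :=
  ∀ (φ : Ed d → ℝ) (x₀ : Ed d), x₀ ∈ U → ContDiffAt ℝ 1 φ x₀ →
    IsLocalMaxOn (fun y => u y - φ y) U x₀ → F (gradient φ x₀) x₀ ≤ μ

/-- Viscosity supersolution of F(Dv, y) ≥ μ in U. -/
def ViscSuper (d : ℕ) (F : Ed d → Ed d → ℝ) (μ : ℝ) (U : Set (Ed d)) (v : Ed d → ℝ) : Prop :=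
  ∀ (φ : Ed d → ℝ) (x₀ : Ed d), x₀ ∈ U → ContDiffAt ℝ 1 φ x₀ →
    IsLocalMinOn (fun y => v y - φ y) U x₀ → μ ≤ F (gradient φ x₀) x₀ 

/-- ω-dependent H̄₊. -/
def HbarPlusOm (d : ℕ) {Ω : Type*} (H : Ed d → Ed d → Ω → ℝ) (p : Ed d) (ω : Ω) : ℝ :=
  sInf {t | ∃ w ∈ SLplus d, t = essSup (fun y => H (p + gradient w y) y ω) volume}

/-- ω-dependent H̄₋. -/
def HbarMinusOm (d : ℕ) {Ω : Type*} (H : Ed d → Ed d → Ω → ℝ) (p : Ed d) (ω : Ω) : ℝ :=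
  sInf {t | ∃ w ∈ SLminus d, t = essSup (fun y => H (p + gradient w y) y ω) volume}

/-- ω-dependent Ĥ. -/
def HhatOm (d : ℕ) {Ω : Type*} (H : Ed d → Ed d → Ω → ℝ) (p : Ed d) (ω : Ω) : ℝ :=
  sInf {t | ∃ w ∈ Scal d, t = essSup (fun y => H (p + gradient w y) y ω) volume}

/-- ω-dependent H̄*. -/
def HstarOm (d : ℕ) {Ω : Type*} (H : Ed d → Ed d → Ω → ℝ) (ω : Ω) : ℝ :=
  sInf {t | ∃ w ∈ LipFuns d, t = essSup (fun y => H (gradient w y) y ω) volume}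

/-- ω-dependent metric problem solution m_μ(y,x,ω). -/
def mMuOm (d : ℕ) {Ω : Type*} (H : Ed d → Ed d → Ω → ℝ) (μ : ℝ) (y x : Ed d) (ω : Ω) : ℝ :=
  sSup {t | ∃ w ∈ LipFuns d, (∀ᵐ z ∂volume, H (gradient w z) z ω ≤ μ) ∧ t = w y - w x}


/-- Orbit sums of an indicator. -/
def orbS {Ω : Type*} (T : Ω → Ω) (B : Set Ω) (n : ℕ) (ω : Ω) : ℝ :=
  ∑ i ∈ Finset.range n, B.indicator (fun _ => (1:ℝ)) (T^[i] ω)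

lemma orbS_add {Ω : Type*} (T : Ω → Ω) (B : Set Ω) (n k : ℕ) (ω : Ω) :
    orbS T B (n + k) ω = orbS T B n ω + orbS T B k (T^[n] ω) := by
  unfold orbS
  rw [Finset.sum_range_add]
  congr 1
  refine Finset.sum_congr rfl fun i _ => ?_
  rw [← Function.iterate_add_apply, add_comm]

lemma orbS_nonneg {Ω : Type*} (T : Ω → Ω) (B : Set Ω) (n : ℕ) (ω : Ω) : 0 ≤ orbS T B n ω :=
  Finset.sum_nonneg fun i _ => Set.indicator_nonneg (fun _ _ => zero_le_one) _

lemma orbS_le {Ω : Type*} (T : Ω → Ω) (B : Set Ω) (n : ℕ) (ω : Ω) : orbS T B n ω ≤ n := by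
  unfold orbS
  refine (Finset.sum_le_sum (g := fun _ => (1:ℝ)) fun i _ => ?_).trans (by simp)
  exact Set.indicator_le' (fun _ _ => le_rfl) (fun _ _ => zero_le_one) _

lemma orbS_one {Ω : Type*} (T : Ω → Ω) (B : Set Ω) (ω : Ω) :
    orbS T B 1 ω = B.indicator (fun _ => (1:ℝ)) ω := by simp [orbS]

lemma orbS_integral {Ω : Type*} [MeasurableSpace Ω] (P : Measure Ω) [IsProbabilityMeasure P]
    {T : Ω → Ω} (hT : MeasurePreserving T P P) {B : Set Ω} (hB : MeasurableSet B) (n : ℕ) :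
    Integrable (orbS T B n) P ∧ ∫ ω, orbS T B n ω ∂P = n * P.real B := by
  have h1 : ∀ i, Integrable (fun ω => B.indicator (fun _ => (1:ℝ)) (T^[i] ω)) P := fun i =>
    (hT.iterate i).integrable_comp_of_integrable ((integrable_const (1:ℝ)).indicator hB)
  refine ⟨by
    have := integrable_finsetSum (Finset.range n) (fun i _ => h1 i)
    exact this, ?_⟩
  unfold orbS
  rw [integral_finsetSum _ fun i _ => h1 i]
  have h2 : ∀ i, ∫ ω, B.indicator (fun _ => (1:ℝ)) (T^[i] ω) ∂P = P.real B := fun i => by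
    have := integral_map (μ := P) (φ := T^[i]) (hT.iterate i).measurable.aemeasurable
      (f := B.indicator (fun _ => (1:ℝ)))
      ((measurable_const.indicator hB).aestronglyMeasurable)
    rw [(hT.iterate i).map_eq] at this
    rw [← this, integral_indicator hB]; simp
  simp [h2]

lemma orbS_cover {Ω : Type*} (T : Ω → Ω) (B : Set Ω) (ε : ℝ) (hε : 0 < ε) (N : ℕ) (K : ℕ) :
    ∀ ω, ε * orbS T {ω | ∃ n, 1 ≤ n ∧ n ≤ N ∧ ε * n < orbS T B n ω} K ω ≤ orbS T B K ω + ε * N := by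
  induction K using Nat.strong_induction_on with
  | _ K ih =>
    intro ω
    set E := {ω | ∃ n, 1 ≤ n ∧ n ≤ N ∧ ε * n < orbS T B n ω} with hE
    rcases Nat.eq_zero_or_pos K with rfl | hK
    · simp [orbS]; positivity
    by_cases hω : ω ∈ E
    · obtain ⟨n, hn1, hnN, hn⟩ := hω
      by_cases hnK : n ≤ K
      · obtain ⟨k, rfl⟩ := Nat.exists_eq_add_of_le hnK
        rw [orbS_add, orbS_add]
        have := ih k (by omega) (T^[n] ω)
        have h3 := orbS_le T E n ω
        have := mul_le_mul_of_nonneg_left h3 hε.le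
        linarith
      · have h3 := orbS_le T E K ω
        have h4 : (K:ℝ) ≤ N := by exact_mod_cast (by omega)
        have := mul_le_mul_of_nonneg_left (h3.trans h4) hε.le
        have := orbS_nonneg T B K ω
        linarith
    · obtain ⟨k, rfl⟩ := Nat.exists_eq_add_of_le (show 1 ≤ K from hK)
      rw [orbS_add, orbS_add, orbS_one]
      have := ih k (by omega) (T^[1] ω)
      rw [Set.indicator_of_notMem hω]
      have := orbS_nonneg T B 1 ω
      linarith

lemma orbS_measurable {Ω : Type*} [MeasurableSpace Ω] {T : Ω → Ω} (hT : Measurable T) {B : Set Ω}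
    (hB : MeasurableSet B) (n : ℕ) : Measurable (orbS T B n) := by
  unfold orbS
  exact Finset.measurable_sum _ fun i _ => (measurable_const.indicator hB).comp (hT.iterate i)

lemma orbS_maximal {Ω : Type*} [MeasurableSpace Ω] (P : Measure Ω) [IsProbabilityMeasure P]
    {T : Ω → Ω} (hT : MeasurePreserving T P P) {B : Set Ω} (hB : MeasurableSet B)
    (ε : ℝ) (hε : 0 < ε) :
    ε * P.real {ω | ∃ n, 1 ≤ n ∧ ε * n < orbS T B n ω} ≤ P.real B := by
  set E : ℕ → Set Ω := fun N => {ω | ∃ n, 1 ≤ n ∧ n ≤ N ∧ ε * n < orbS T B n ω} with hE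
  have hEm : ∀ N, MeasurableSet (E N) := by
    intro N
    have : E N = ⋃ n, ⋃ (_ : 1 ≤ n ∧ n ≤ N), {ω | ε * n < orbS T B n ω} := by
      ext ω; simp [hE, and_assoc]
    rw [this]
    exact MeasurableSet.iUnion fun n => MeasurableSet.iUnion fun _ =>
      measurableSet_lt measurable_const (orbS_measurable hT.measurable hB n)
  have key : ∀ N, ε * P.real (E N) ≤ P.real B := by
    intro N
    have h : ∀ K : ℕ, K * (ε * P.real (E N) - P.real B) ≤ ε * N := by
      intro K
      have h1 := orbS_integral P hT (hEm N) K
      have h2 := orbS_integral P hT hB K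
      have := integral_mono (μ := P) (h1.1.const_mul ε) (h2.1.add (integrable_const (ε * N)))
        (fun ω => orbS_cover T B ε hε N K ω)
      rw [integral_const_mul, integral_add' h2.1 (integrable_const _), h1.2, h2.2] at this
      simp at this
      nlinarith
    by_contra hcon
    push Not at hcon
    obtain ⟨K, hK⟩ := exists_nat_gt (ε * N / (ε * P.real (E N) - P.real B))
    rw [div_lt_iff₀ (by linarith)] at hK
    linarith [h K]
  have hU : {ω | ∃ n, 1 ≤ n ∧ ε * n < orbS T B n ω} = ⋃ N, E N := by
    ext ω; simp only [hE, Set.mem_setOf_eq, Set.mem_iUnion]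
    constructor
    · rintro ⟨n, h1, h2⟩; exact ⟨n, n, h1, le_rfl, h2⟩
    · rintro ⟨N, n, h1, _, h2⟩; exact ⟨n, h1, h2⟩
  have hmono : Monotone E := by
    intro N M hNM ω hω
    obtain ⟨n, h1, h2, h3⟩ := hω
    exact ⟨n, h1, h2.trans hNM, h3⟩
  have ht : Tendsto (fun N => P.real (E N)) atTop (𝓝 (P.real (⋃ N, E N))) := by
    have := tendsto_measure_iUnion_atTop (μ := P) hmono
    exact (ENNReal.tendsto_toReal (measure_ne_top _ _)).comp this
  rw [hU]
  exact le_of_tendsto' (ht.const_mul ε) key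

/-- Decreasing sets with null intersection are visited with small frequency. -/
lemma orbS_small {Ω : Type*} [MeasurableSpace Ω] (P : Measure Ω) [IsProbabilityMeasure P]
    {T : Ω → Ω} (hT : MeasurePreserving T P P) {B : ℕ → Set Ω} (hB : ∀ j, MeasurableSet (B j))
    (hanti : Antitone B) (hnull : P (⋂ j, B j) = 0) (ε : ℝ) (hε : 0 < ε) :
    ∀ᵐ ω ∂P, ∃ j, ∀ n : ℕ, orbS T (B j) n ω ≤ ε * n := by
  have h1 : ∀ j, P.real {ω | ¬ ∃ j, ∀ n : ℕ, orbS T (B j) n ω ≤ ε * n} ≤ P.real (B j) / ε := by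
    intro j
    rw [le_div_iff₀ hε, mul_comm]
    refine le_trans ?_ (orbS_maximal P hT (hB j) ε hε)
    refine mul_le_mul_of_nonneg_left ?_ hε.le
    refine measureReal_mono ?_
    intro ω hω
    simp only [Set.mem_setOf_eq, not_exists, not_forall, not_le] at hω
    obtain ⟨n, hn⟩ := hω j
    refine ⟨n, ?_, hn⟩
    rcases Nat.eq_zero_or_pos n with rfl | h
    · simp [orbS] at hn
    · exact h
  have ht : Tendsto (fun j => P.real (B j) / ε) atTop (𝓝 (0 / ε)) := by
    have := tendsto_measure_iInter_atTop (μ := P) (fun j => (hB j).nullMeasurableSet) hanti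
      ⟨0, measure_ne_top _ _⟩
    rw [hnull] at this
    exact ((ENNReal.tendsto_toReal (by simp)).comp this).div_const ε
  have h2 := ge_of_tendsto' ht h1
  rw [zero_div] at h2
  have h3 := le_antisymm h2 measureReal_nonneg
  rw [measureReal_eq_zero_iff] at h3
  exact h3


/-- Stationary, subadditive, Lipschitz family. -/
structure ErgF (d : ℕ) {Ω : Type*} [MeasurableSpace Ω] (τ : Ed d → Ω → Ω)
    (F : Ed d → Ed d → Ω → ℝ) (R : ℝ) : Prop where
  meas : ∀ y x, Measurable (F y x)
  stat : ∀ y x z ω, F y x (τ z ω) = F (y + z) (x + z) ω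
  sub : ∀ x y z ω, F z x ω ≤ F z y ω + F y x ω
  bd : ∀ y x ω, |F y x ω| ≤ R * ‖y - x‖

section erg
variable {d : ℕ} {Ω : Type*} [MeasurableSpace Ω] {τ : Ed d → Ω → Ω}
  {F : Ed d → Ed d → Ω → ℝ} {R : ℝ}

lemma ErgF.lip1 (h : ErgF d τ F R) (y x y' x' : Ed d) (ω : Ω) :
    F y x ω ≤ F y' x' ω + R * (‖y - y'‖ + ‖x - x'‖) := by
  have h1 := h.sub x x' y ω
  have h2 := h.sub x' y' y ω
  have h3 := (abs_le.1 (h.bd y y' ω)).2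
  have h4 := (abs_le.1 (h.bd x' x ω)).2
  rw [norm_sub_rev] at h4
  linarith

lemma ErgF.lip (h : ErgF d τ F R) (y x y' x' : Ed d) (ω : Ω) :
    |F y x ω - F y' x' ω| ≤ R * (‖y - y'‖ + ‖x - x'‖) := by
  have h1 := h.lip1 y x y' x' ω
  have h2 := h.lip1 y' x' y x ω
  rw [norm_sub_rev y' y, norm_sub_rev x' x] at h2
  rw [abs_le]; constructor <;> linarith

lemma tau_iter (hτgrp : ∀ x y : Ed d, τ (x + y) = τ x ∘ τ y) (hτzero : τ 0 = id)
    (v : Ed d) (n : ℕ) (ω : Ω) : (τ v)^[n] ω = τ ((n:ℝ) • v) ω := by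
  induction n with
  | zero => simp [hτzero]
  | succ n ih =>
    rw [Function.iterate_succ_apply', ih]
    have := hτgrp v ((n:ℝ) • v)
    rw [← Function.comp_apply (f := τ v), ← this]
    congr 1
    push_cast
    rw [add_smul, one_smul, add_comm]

lemma ErgF.const (h : ErgF d τ F R) (hR : 0 ≤ R) (P : Measure Ω) [IsProbabilityMeasure P]
    (hτerg : ∀ A : Set Ω, MeasurableSet A → (∀ z : Ed d, τ z ⁻¹' A = A) → P A = 0 ∨ P A = 1)
    (hτgrp : ∀ x y : Ed d, τ (x + y) = τ x ∘ τ y) (hτzero : τ 0 = id)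
    (v : Ed d) :
    ∃ c : ℝ, ∀ ε : ℝ, 0 < ε →
      (∀ᵐ ω ∂P, ∃ᶠ n : ℕ in atTop, F ((n:ℝ) • v) 0 ω < (c + ε) * n) ∧
      (∀ᵐ ω ∂P, ∀ᶠ n : ℕ in atTop, (c - ε) * n ≤ F ((n:ℝ) • v) 0 ω) := by
  set A : ℝ → Set Ω := fun q => {ω | ∃ k : ℕ, ∃ᶠ n : ℕ in atTop,
    F ((n:ℝ) • v) 0 ω < (q - 1 / ((k:ℝ) + 1)) * n} with hA
  have hAm : ∀ q, MeasurableSet (A q) := by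
    intro q
    have : A q = ⋃ k : ℕ, ⋂ N : ℕ, ⋃ n : ℕ, ⋃ (_ : N ≤ n),
        {ω | F ((n:ℝ) • v) 0 ω < (q - 1 / ((k:ℝ) + 1)) * n} := by
      ext ω; simp [hA, frequently_atTop]
    rw [this]
    refine MeasurableSet.iUnion fun k => MeasurableSet.iInter fun N => MeasurableSet.iUnion fun n =>
      MeasurableSet.iUnion fun _ => measurableSet_lt (h.meas _ _) measurable_const
  have hsubset : ∀ q z, τ z ⁻¹' A q ⊆ A q := by
    rintro q z ω ⟨k, hk⟩
    refine ⟨k + 1, ?_⟩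
    obtain ⟨N, hN⟩ := exists_nat_gt ((R * (‖z‖ + ‖z‖)) / (1 / ((k:ℝ) + 1) - 1 / ((k:ℝ) + 1 + 1)))
    refine (hk.and_eventually (eventually_ge_atTop N)).mono ?_
    rintro n ⟨hn, hNn⟩
    rw [h.stat] at hn
    have h1 := h.lip1 ((n:ℝ) • v) 0 ((n:ℝ) • v + z) (0 + z) ω
    have hz : ‖(n:ℝ) • v - ((n:ℝ) • v + z)‖ = ‖z‖ := by rw [sub_add_cancel_left, norm_neg]
    have hz' : ‖(0:Ed d) - (0 + z)‖ = ‖z‖ := by simp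
    rw [hz, hz'] at h1
    have hpos : 0 < 1 / ((k:ℝ) + 1) - 1 / ((k:ℝ) + 1 + 1) := by
      rw [sub_pos]; exact one_div_lt_one_div_of_lt (by positivity) (by linarith)
    rw [div_lt_iff₀ hpos] at hN
    have hNn' : (N:ℝ) ≤ n := by exact_mod_cast hNn
    have := mul_le_mul_of_nonneg_right hNn' hpos.le
    push_cast
    linarith
  have hinv : ∀ q z, τ z ⁻¹' A q = A q := by
    intro q z
    refine Set.Subset.antisymm (hsubset q z) ?_
    intro ω hω
    have h1 : τ (-z) (τ z ω) = ω := by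
      have := congrFun (hτgrp (-z) z) ω
      rw [neg_add_cancel, hτzero] at this
      exact this.symm
    refine hsubset q (-z) ?_
    rw [Set.mem_preimage, h1]; exact hω
  have h01 := fun q => hτerg (A q) (hAm q) (hinv q)
  have hmono : ∀ q q', q ≤ q' → A q ⊆ A q' := by
    rintro q q' hq ω ⟨k, hk⟩
    refine ⟨k, hk.mono fun n hn => hn.trans_le ?_⟩
    gcongr
  have hbig : ∀ ω, ω ∈ A (R * ‖v‖ + 2) := by
    intro ω
    refine ⟨0, Eventually.frequently ?_⟩
    filter_upwards [eventually_gt_atTop 0] with n hn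
    have := (abs_le.1 (h.bd ((n:ℝ) • v) 0 ω)).2
    rw [sub_zero, norm_smul, Real.norm_natCast] at this
    have hn' : (0:ℝ) < n := by exact_mod_cast hn
    norm_num
    nlinarith
  have hsmall : ∀ ω, ω ∉ A (- (R * ‖v‖)) := by
    rintro ω ⟨k, hk⟩
    obtain ⟨n, hn⟩ := hk.exists
    have := (abs_le.1 (h.bd ((n:ℝ) • v) 0 ω)).1
    rw [sub_zero, norm_smul, Real.norm_natCast] at this
    have hk : 0 ≤ 1 / ((k:ℝ) + 1) := by positivity
    have hn' : (0:ℝ) ≤ n := by positivity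
    nlinarith
  set Q := {q : ℝ | P (A q) = 1} with hQ
  have hne : Q.Nonempty := ⟨R * ‖v‖ + 2, by
    have : A (R * ‖v‖ + 2) = Set.univ := Set.eq_univ_of_forall hbig
    show P _ = 1
    rw [this]; simp⟩
  have hbb : BddBelow Q := ⟨- (R * ‖v‖), by
    intro q hq
    by_contra hcon
    push Not at hcon
    have : A q = ∅ := by
      ext ω; simp only [Set.mem_empty_iff_false, iff_false]
      exact fun hω => hsmall ω (hmono _ _ hcon.le hω)
    have hq' : P (A q) = 1 := hq
    rw [this] at hq'; simp at hq'⟩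
  refine ⟨sInf Q, fun ε hε => ⟨?_, ?_⟩⟩
  · obtain ⟨q, hq, hlt⟩ := exists_lt_of_csInf_lt hne (show sInf Q < sInf Q + ε by linarith)
    have hq' : ∀ᵐ ω ∂P, ω ∈ A q := by
      have hq1 : P (A q) = 1 := hq
      rw [← prob_compl_eq_zero_iff (hAm q)] at hq1
      exact hq1
    filter_upwards [hq'] with ω hω
    obtain ⟨k, hk⟩ := hω
    refine hk.mono fun n hn => hn.trans_le ?_
    have hk : 0 ≤ 1 / ((k:ℝ) + 1) := by positivity
    gcongr
    linarith
  · have hq : sInf Q - ε / 2 ∉ Q := fun hq => by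
      have := csInf_le hbb hq
      linarith
    have hq0 : P (A (sInf Q - ε / 2)) = 0 := (h01 _).resolve_right hq
    have hq' : ∀ᵐ ω ∂P, ω ∉ A (sInf Q - ε / 2) := measure_eq_zero_iff_ae_notMem.1 hq0
    filter_upwards [hq'] with ω hω
    by_contra hcon
    apply hω
    obtain ⟨k, hk⟩ := exists_nat_one_div_lt (show 0 < ε / 2 by linarith)
    refine ⟨k, ?_⟩
    rw [not_eventually] at hcon
    refine hcon.mono fun n hn => ?_
    push Not at hn
    refine hn.trans_le ?_
    refine mul_le_mul_of_nonneg_right ?_ (by positivity)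
    linarith

lemma ErgF.cover (h : ErgF d τ F R) (hR : 0 ≤ R)
    (v : Ed d) (a C : ℝ) (hC : 0 ≤ C) (hC' : R * ‖v‖ ≤ a + C) (B : Set Ω) (N : ℕ)
    (hB : ∀ ω ∉ B, ∃ n : ℕ, 1 ≤ n ∧ n ≤ N ∧ F ((n:ℝ) • v) 0 ω ≤ a * n) (K : ℕ)
    (hτgrp : ∀ x y : Ed d, τ (x + y) = τ x ∘ τ y) (hτzero : τ 0 = id) :
    ∀ ω, F ((K:ℝ) • v) 0 ω ≤ a * K + C * orbS (τ v) B K ω + C * N := by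
  have hsplit : ∀ (n k : ℕ) ω, F (((n + k : ℕ):ℝ) • v) 0 ω ≤
      F ((k:ℝ) • v) 0 ((τ v)^[n] ω) + F ((n:ℝ) • v) 0 ω := by
    intro n k ω
    rw [tau_iter hτgrp hτzero, h.stat]
    have := h.sub 0 ((n:ℝ) • v) (((n + k : ℕ):ℝ) • v) ω
    have e : ((n + k : ℕ):ℝ) • v = (k:ℝ) • v + (n:ℝ) • v := by push_cast; rw [add_smul, add_comm]
    rw [e] at this ⊢
    rwa [zero_add]
  have hbd : ∀ (n : ℕ) ω, F ((n:ℝ) • v) 0 ω ≤ R * ‖v‖ * n := by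
    intro n ω
    have := (abs_le.1 (h.bd ((n:ℝ) • v) 0 ω)).2
    rw [sub_zero, norm_smul, Real.norm_natCast] at this
    linarith
  induction K using Nat.strong_induction_on with
  | _ K ih =>
    intro ω
    rcases Nat.eq_zero_or_pos K with rfl | hK
    · have := hbd 0 ω
      simp only [orbS, Finset.range_zero, Finset.sum_empty, Nat.cast_zero] at this ⊢
      have : 0 ≤ C * N := by positivity
      linarith
    by_cases hω : ω ∈ B
    · obtain ⟨k, rfl⟩ := Nat.exists_eq_add_of_le (show 1 ≤ K from hK)
      have h1 := hsplit 1 k ω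
      have h2 := ih k (by omega) ((τ v)^[1] ω)
      have h3 := hbd 1 ω
      rw [orbS_add, orbS_one, Set.indicator_of_mem hω]
      push_cast at *
      linarith
    · obtain ⟨n, hn1, hnN, hn⟩ := hB ω hω
      by_cases hnK : n ≤ K
      · obtain ⟨k, rfl⟩ := Nat.exists_eq_add_of_le hnK
        have h1 := hsplit n k ω
        have h2 := ih k (by omega) ((τ v)^[n] ω)
        have h3 := mul_nonneg hC (orbS_nonneg (τ v) B n ω)
        rw [orbS_add]
        push_cast at *
        linarith
      · have h3 := hbd K ω
        have h4 : (K:ℝ) ≤ N := by exact_mod_cast (by omega)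
        have h5 := mul_le_mul_of_nonneg_left h4 hC
        have h6 := mul_le_mul_of_nonneg_right hC' (show (0:ℝ) ≤ K by positivity)
        have h7 := mul_nonneg hC (orbS_nonneg (τ v) B K ω)
        linarith

lemma ErgF.lim0 (h : ErgF d τ F R) (hR : 0 ≤ R) (P : Measure Ω) [IsProbabilityMeasure P]
    (hτmp : ∀ y : Ed d, MeasurePreserving (τ y) P P)
    (hτerg : ∀ A : Set Ω, MeasurableSet A → (∀ z : Ed d, τ z ⁻¹' A = A) → P A = 0 ∨ P A = 1)
    (hτgrp : ∀ x y : Ed d, τ (x + y) = τ x ∘ τ y) (hτzero : τ 0 = id)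
    (v : Ed d) :
    ∃ c : ℝ, ∀ ε : ℝ, 0 < ε →
      ∀ᵐ ω ∂P, ∀ᶠ n : ℕ in atTop, |F ((n:ℝ) • v) 0 ω - c * n| ≤ ε * n := by
  obtain ⟨c, hc⟩ := h.const hR P hτerg hτgrp hτzero v
  refine ⟨c, fun ε hε => ?_⟩
  set a := c + ε / 2 with ha
  set C := R * ‖v‖ + |a| with hCdef
  have hC : 0 ≤ C := by positivity
  have hC' : R * ‖v‖ ≤ a + C := by
    have := neg_abs_le a
    linarith
  set B : ℕ → Set Ω := fun N => {ω | ∀ n : ℕ, 1 ≤ n → n ≤ N → a * n < F ((n:ℝ) • v) 0 ω} with hB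
  have hBm : ∀ N, MeasurableSet (B N) := by
    intro N
    have : B N = ⋂ n : ℕ, ⋂ (_ : 1 ≤ n), ⋂ (_ : n ≤ N), {ω | a * n < F ((n:ℝ) • v) 0 ω} := by
      ext ω; simp [hB]
    rw [this]
    exact MeasurableSet.iInter fun n => MeasurableSet.iInter fun _ => MeasurableSet.iInter fun _ =>
      measurableSet_lt measurable_const (h.meas _ _)
  have hanti : Antitone B := fun N M hNM ω hω n h1 h2 => hω n h1 (h2.trans hNM)
  have hnull : P (⋂ j, B j) = 0 := by
    rw [measure_eq_zero_iff_ae_notMem]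
    filter_upwards [(hc (ε / 2) (by linarith)).1] with ω hω hmem
    rw [Set.mem_iInter] at hmem
    obtain ⟨n, hn, h1⟩ := (hω.and_eventually (eventually_ge_atTop 1)).exists
    exact absurd (hmem n n h1 le_rfl) (not_lt.2 hn.le)
  have hfreq := orbS_small P (hτmp v) hBm hanti hnull (ε / (4 * (C + 1))) (by positivity)
  filter_upwards [hfreq, (hc ε hε).2] with ω hω hlow
  obtain ⟨j, hj⟩ := hω
  obtain ⟨M, hM⟩ := exists_nat_gt (C * j / (ε / 4))
  rw [div_lt_iff₀ (by linarith)] at hM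
  filter_upwards [hlow, eventually_ge_atTop M] with n hn hMn
  have hMn' : (M:ℝ) ≤ n := by exact_mod_cast hMn
  have hcov := h.cover hR v a C hC hC' (B j) j (by
    intro ω hω
    simp only [hB, Set.mem_ofPred_eq, not_forall, not_lt] at hω
    obtain ⟨n, h1, h2, h3⟩ := hω
    exact ⟨n, h1, h2, h3⟩) n hτgrp hτzero ω
  have h1 : C * orbS (τ v) (B j) n ω ≤ ε / 4 * n := by
    calc C * orbS (τ v) (B j) n ω ≤ (C + 1) * (ε / (4 * (C + 1)) * n) := by
          have := hj n
          have := orbS_nonneg (τ v) (B j) n ω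
          gcongr
          linarith
      _ = ε / 4 * n := by field_simp
  have h2 := mul_le_mul_of_nonneg_right hMn' (show 0 ≤ ε / 4 by linarith)
  rw [abs_le]
  constructor <;> nlinarith

lemma ErgF.lim1 (h : ErgF d τ F R) (hR : 0 ≤ R) (P : Measure Ω) [IsProbabilityMeasure P]
    (hτmp : ∀ y : Ed d, MeasurePreserving (τ y) P P)
    (hτgrp : ∀ x y : Ed d, τ (x + y) = τ x ∘ τ y) (hτzero : τ 0 = id)
    (v x : Ed d) (c : ℝ) (hc : ∀ ε : ℝ, 0 < ε →
      ∀ᵐ ω ∂P, ∀ᶠ n : ℕ in atTop, |F ((n:ℝ) • v) 0 ω - c * n| ≤ ε * n) (ε : ℝ) (hε : 0 < ε) :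
    ∀ᵐ ω ∂P, ∀ᶠ n : ℕ in atTop, |F ((n:ℝ) • (x + v)) ((n:ℝ) • x) ω - c * n| ≤ ε * n := by
  set B : ℕ → Set Ω := fun N => {ω | ∃ n : ℕ, N ≤ n ∧ ε / 2 * n < |F ((n:ℝ) • v) 0 ω - c * n|}
    with hB
  have hBm : ∀ N, MeasurableSet (B N) := by
    intro N
    have : B N = ⋃ n : ℕ, ⋃ (_ : N ≤ n), {ω | ε / 2 * n < |F ((n:ℝ) • v) 0 ω - c * n|} := by
      ext ω; simp [hB]
    rw [this]
    exact MeasurableSet.iUnion fun n => MeasurableSet.iUnion fun _ =>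
      measurableSet_lt measurable_const ((h.meas _ _).sub_const _).norm
  have hanti : Antitone B := by
    rintro N M hNM ω ⟨n, h1, h2⟩
    exact ⟨n, hNM.trans h1, h2⟩
  have hnull : P (⋂ j, B j) = 0 := by
    rw [measure_eq_zero_iff_ae_notMem]
    filter_upwards [hc (ε / 2) (by linarith)] with ω hω hmem
    rw [Set.mem_iInter] at hmem
    obtain ⟨N, hN⟩ := eventually_atTop.1 hω
    obtain ⟨n, h1, h2⟩ := hmem N
    exact absurd (hN n h1) (not_le.2 h2)
  set D := 2 * R * ‖x‖ + 1 with hD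
  have hDpos : 0 < D := by positivity
  set η := min (ε / (8 * D)) (1 / 2) with hη
  have hηpos : 0 < η := by positivity
  have hη2 : η ≤ 1 / 2 := min_le_right _ _
  have hη1 : η ≤ ε / (8 * D) := min_le_left _ _
  filter_upwards [orbS_small P (hτmp x) hBm hanti hnull η hηpos] with ω hω
  obtain ⟨j, hj⟩ := hω
  filter_upwards [eventually_ge_atTop 1, eventually_ge_atTop j] with n hMn hjn
  -- find a good index
  have hex : ∃ i : ℕ, i ≤ n ∧ (n:ℝ) - i ≤ 3 * η * n ∧ (τ x)^[i] ω ∉ B j := by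
    by_contra hcon
    push Not at hcon
    have hn1' : (1:ℝ) ≤ n := by exact_mod_cast hMn
    obtain ⟨k, hk1, hk2⟩ : ∃ k : ℕ, η * (n + 1) < k ∧ (k:ℝ) ≤ η * (n + 1) + 1 :=
      ⟨⌊η * (n + 1)⌋₊ + 1, by push_cast; exact Nat.lt_floor_add_one _, by
        push_cast; linarith [Nat.floor_le (show 0 ≤ η * ((n:ℝ) + 1) by positivity)]⟩
    have hkn : k ≤ n + 1 := by
      have : (k:ℝ) ≤ n + 1 := by nlinarith
      exact_mod_cast this
    obtain ⟨l, hl⟩ := Nat.exists_eq_add_of_le hkn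
    have hl' : (n:ℝ) + 1 = k + l := by exact_mod_cast hl
    have h1 := hj (l + k)
    rw [orbS_add] at h1
    have h2 : orbS (τ x) (B j) k ((τ x)^[l] ω) = k := by
      unfold orbS
      rw [Finset.sum_congr rfl (g := fun _ => (1:ℝ))]
      · simp
      intro i hi
      rw [Finset.mem_range] at hi
      rw [Set.indicator_of_mem]
      rw [← Function.iterate_add_apply]
      refine hcon _ (by omega) ?_
      have : (0:ℝ) ≤ i := by positivity
      push_cast
      nlinarith
    have h3 := orbS_nonneg (τ x) (B j) l ω
    rw [h2] at h1
    have e : ((l + k : ℕ):ℝ) = n + 1 := by push_cast; linarith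
    rw [e] at h1
    linarith
  obtain ⟨i, hin, hi, hgood⟩ := hex
  have hg : |F ((n:ℝ) • v) 0 ((τ x)^[i] ω) - c * n| ≤ ε / 2 * n := by
    by_contra hcon
    push Not at hcon
    exact hgood ⟨n, hjn, hcon⟩
  rw [tau_iter hτgrp hτzero, h.stat, zero_add] at hg
  have hl := h.lip ((n:ℝ) • (x + v)) ((n:ℝ) • x) ((n:ℝ) • v + (i:ℝ) • x) ((i:ℝ) • x) ω
  have hin' : (i:ℝ) ≤ n := by exact_mod_cast hin
  have e1 : ‖(n:ℝ) • (x + v) - ((n:ℝ) • v + (i:ℝ) • x)‖ = (n - i) * ‖x‖ := by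
    have : (n:ℝ) • (x + v) - ((n:ℝ) • v + (i:ℝ) • x) = ((n:ℝ) - i) • x := by module
    rw [this, norm_smul, Real.norm_of_nonneg (by linarith)]
  have e2 : ‖(n:ℝ) • x - (i:ℝ) • x‖ = (n - i) * ‖x‖ := by
    have : (n:ℝ) • x - (i:ℝ) • x = ((n:ℝ) - i) • x := by module
    rw [this, norm_smul, Real.norm_of_nonneg (by linarith)]
  rw [e1, e2] at hl
  have h5 : R * ((n - i) * ‖x‖ + (n - i) * ‖x‖) ≤ ε / 2 * n := by
    calc R * ((n - i) * ‖x‖ + (n - i) * ‖x‖) = (2 * R * ‖x‖) * (n - i) := by ring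
      _ ≤ D * (3 * η * n) := by
        have : (0:ℝ) ≤ n - i := by linarith
        gcongr
        linarith
      _ ≤ D * (3 * (ε / (8 * D)) * n) := by gcongr
      _ = 3 / 8 * ε * n := by field_simp
      _ ≤ ε / 2 * n := by
        have : (0:ℝ) ≤ ε * n := by positivity
        linarith
  have h6 := abs_sub_le (F ((n:ℝ) • (x + v)) ((n:ℝ) • x) ω)
    (F ((n:ℝ) • v + (i:ℝ) • x) ((i:ℝ) • x) ω) (c * n)
  linarith

/-- The ergodic theorem for stationary subadditive Lipschitz families. -/
lemma ErgF.main (h : ErgF d τ F R) (hR : 0 ≤ R) (P : Measure Ω) [IsProbabilityMeasure P]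
    (hτmp : ∀ y : Ed d, MeasurePreserving (τ y) P P)
    (hτerg : ∀ A : Set Ω, MeasurableSet A → (∀ z : Ed d, τ z ⁻¹' A = A) → P A = 0 ∨ P A = 1)
    (hτgrp : ∀ x y : Ed d, τ (x + y) = τ x ∘ τ y) (hτzero : τ 0 = id) :
    ∃ c : Ed d → ℝ, ∀ᵐ ω ∂P, ∀ x y : Ed d,
      Tendsto (fun t : ℝ => t⁻¹ * F (t • y) (t • x) ω) atTop (𝓝 (c (y - x))) := by
  choose c hc using fun v => h.lim0 hR P hτmp hτerg hτgrp hτzero v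
  refine ⟨c, ?_⟩
  have hclip : ∀ v v', |c v - c v'| ≤ R * ‖v - v'‖ := by
    intro v v'
    refine le_of_forall_pos_le_add fun ε hε => ?_
    obtain ⟨ω, h1, h2⟩ := ((hc v (ε / 2) (by linarith)).and (hc v' (ε / 2) (by linarith))).exists
    obtain ⟨n, ⟨h1, h2⟩, hn⟩ := ((h1.and h2).and (eventually_gt_atTop 0)).exists
    have hn' : (0:ℝ) < n := by exact_mod_cast hn
    have h3 := h.lip ((n:ℝ) • v) 0 ((n:ℝ) • v') 0 ω
    rw [← smul_sub, norm_smul, Real.norm_natCast, sub_zero, norm_zero, add_zero] at h3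
    rw [abs_le] at h1 h2 h3 ⊢
    constructor
    · refine le_of_mul_le_mul_right ?_ hn'
      nlinarith
    · refine le_of_mul_le_mul_right ?_ hn'
      nlinarith
  obtain ⟨s, hs, hsd⟩ := TopologicalSpace.exists_countable_dense (Ed d)
  have hall : ∀ᵐ ω ∂P, ∀ v ∈ s, ∀ x ∈ s, ∀ k : ℕ, ∀ᶠ n : ℕ in atTop,
      |F ((n:ℝ) • (x + v)) ((n:ℝ) • x) ω - c v * n| ≤ 1 / ((k:ℝ) + 1) * n := by
    rw [ae_ball_iff hs]
    intro v _
    rw [ae_ball_iff hs]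
    intro x _
    rw [ae_all_iff]
    intro k
    exact h.lim1 hR P hτmp hτgrp hτzero v x (c v) (hc v) _ (by positivity)
  filter_upwards [hall] with ω hω x y
  rw [Metric.tendsto_atTop]
  intro ε hε
  -- approximate
  set δ := ε / (8 * (R + 1)) with hδ
  have hδpos : 0 < δ := by positivity
  obtain ⟨x', hx's, hx'⟩ := hsd.exists_dist_lt x hδpos
  obtain ⟨v', hv's, hv'⟩ := hsd.exists_dist_lt (y - x) hδpos
  rw [dist_eq_norm] at hx' hv'
  obtain ⟨k, hk⟩ := exists_nat_one_div_lt (show 0 < ε / 8 by linarith)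
  obtain ⟨N, hN⟩ := eventually_atTop.1 (hω v' hv's x' hx's k)
  set L := R * (‖y‖ + ‖x‖) + |c v'| with hL
  have hLpos : 0 ≤ L := by positivity
  refine ⟨max ((N:ℝ) + 1) (8 * L / ε + 1), fun t ht => ?_⟩
  have ht1 : (N:ℝ) + 1 ≤ t := (le_max_left _ _).trans ht
  have ht2 : 8 * L / ε + 1 ≤ t := (le_max_right _ _).trans ht
  have htpos : 0 < t := by have : (0:ℝ) ≤ N := by positivity
                           linarith
  have hLt : L ≤ ε / 8 * t := by
    have : 8 * L / ε ≤ t := by linarith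
    rw [div_le_iff₀ hε] at this
    linarith
  set n := ⌊t⌋₊ with hn
  have hn1 : (n:ℝ) ≤ t := Nat.floor_le htpos.le
  have hn2 : t < n + 1 := Nat.lt_floor_add_one t
  have hNn : N ≤ n := Nat.le_floor (by linarith)
  have hA := hN n hNn
  have hB := h.lip (t • y) (t • x) ((n:ℝ) • y) ((n:ℝ) • x) ω
  rw [← sub_smul, ← sub_smul, norm_smul, norm_smul, Real.norm_of_nonneg (show 0 ≤ t - n by linarith)]
    at hB
  have hC := h.lip ((n:ℝ) • y) ((n:ℝ) • x) ((n:ℝ) • (x' + v')) ((n:ℝ) • x') ω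
  rw [← smul_sub, ← smul_sub, norm_smul, norm_smul, Real.norm_natCast] at hC
  have hD := hclip v' (y - x)
  rw [norm_sub_rev] at hD
  have hE : ‖y - (x' + v')‖ ≤ δ + δ := by
    have : y - (x' + v') = (x - x') + (y - x - v') := by abel
    rw [this]
    exact (norm_add_le _ _).trans (by linarith)
  have hRδ : R * δ ≤ ε / 8 := by
    have : (R + 1) * δ = ε / 8 := by rw [hδ]; field_simp
    linarith
  have hB' : R * ((t - n) * ‖y‖ + (t - n) * ‖x‖) ≤ R * (‖y‖ + ‖x‖) := by
    have : (t - n) * (‖y‖ + ‖x‖) ≤ 1 * (‖y‖ + ‖x‖) := by gcongr; linarith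
    refine mul_le_mul_of_nonneg_left ?_ hR
    linarith
  have hC' : R * (n * ‖y - (x' + v')‖ + n * ‖x - x'‖) ≤ 3 * (ε / 8) * t := by
    calc R * (n * ‖y - (x' + v')‖ + n * ‖x - x'‖) ≤ R * (n * (δ + δ) + n * δ) := by gcongr
      _ = 3 * (R * δ) * n := by ring
      _ ≤ 3 * (ε / 8) * t := by gcongr
  have hF : |c v' * n - c v' * t| ≤ |c v'| := by
    rw [← mul_sub, abs_mul]
    have : |(n:ℝ) - t| ≤ 1 := by rw [abs_le]; constructor <;> linarith
    exact mul_le_of_le_one_right (abs_nonneg _) this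
  have hG : |c v' * t - c (y - x) * t| ≤ ε / 8 * t := by
    rw [← sub_mul, abs_mul, abs_of_pos htpos]
    gcongr
    refine hD.trans (le_trans ?_ hRδ)
    gcongr
  have hk' : 1 / ((k:ℝ) + 1) * n ≤ ε / 8 * t := by gcongr
  have htot : |F (t • y) (t • x) ω - c (y - x) * t| ≤ 6 * (ε / 8) * t := by
    rw [abs_le] at *
    constructor <;> linarith
  rw [Real.dist_eq]
  have e : t⁻¹ * F (t • y) (t • x) ω - c (y - x) = t⁻¹ * (F (t • y) (t • x) ω - c (y - x) * t) := by
    field_simp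
  rw [e, abs_mul, abs_of_pos (inv_pos.2 htpos)]
  calc t⁻¹ * |F (t • y) (t • x) ω - c (y - x) * t| ≤ t⁻¹ * (6 * (ε / 8) * t) := by gcongr
    _ = 6 * (ε / 8) := by field_simp
    _ < ε := by linarith

lemma ErgF.props (h : ErgF d τ F R) (hR : 0 ≤ R) (ω : Ω) (c : Ed d → ℝ)
    (hc : ∀ x y : Ed d,
      Tendsto (fun t : ℝ => t⁻¹ * F (t • y) (t • x) ω) atTop (𝓝 (c (y - x)))) :
    (∃ C : ℝ≥0, LipschitzWith C c) ∧
          (∀ s : ℝ, 0 ≤ s → ∀ y : Ed d, c (s • y) = s * c y) ∧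
          ConvexOn ℝ Set.univ c := by
  have hbd : ∀ v, c v ≤ R * ‖v‖ := by
    intro v
    have h1 := hc 0 v
    rw [sub_zero] at h1
    refine le_of_tendsto h1 ?_
    filter_upwards [eventually_gt_atTop 0] with t ht
    have := (abs_le.1 (h.bd (t • v) (t • (0 : Ed d)) ω)).2
    rw [smul_zero, sub_zero, norm_smul, Real.norm_of_nonneg ht.le] at this
    rw [smul_zero, inv_mul_le_iff₀ ht]
    linarith
  have hsub : ∀ u v, c (u + v) ≤ c u + c v := by
    intro u v
    have h1 := hc 0 (u + v)
    have h2 := hc u (u + v)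
    have h3 := hc 0 u
    rw [sub_zero] at h1 h3
    rw [add_sub_cancel_left] at h2
    rw [add_comm (c u)]
    refine le_of_tendsto_of_tendsto h1 (h2.add h3) ?_
    filter_upwards [eventually_gt_atTop 0] with t ht
    rw [← mul_add]
    exact mul_le_mul_of_nonneg_left (h.sub _ _ _ _) (inv_pos.2 ht).le
  have hhom : ∀ s : ℝ, 0 ≤ s → ∀ y : Ed d, c (s • y) = s * c y := by
    intro s hs y
    rcases hs.eq_or_lt with rfl | hs
    · rw [zero_smul, zero_mul]
      have h1 := hc 0 0
      rw [sub_zero] at h1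
      refine tendsto_nhds_unique h1 ?_
      have : (fun t : ℝ => t⁻¹ * F (t • (0:Ed d)) (t • (0:Ed d)) ω) = fun _ => 0 := by
        funext t
        have := h.bd (t • (0:Ed d)) (t • (0:Ed d)) ω
        rw [sub_self, norm_zero, mul_zero] at this
        rw [abs_nonpos_iff.1 this, mul_zero]
      rw [this]; exact tendsto_const_nhds
    · have h1 := hc 0 (s • y)
      have h2 := (hc 0 y).comp (tendsto_id.atTop_mul_const hs)
      rw [sub_zero] at h1 h2
      refine tendsto_nhds_unique h1 ((h2.const_mul s).congr fun t => ?_)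
      simp only [Function.comp, id, smul_zero, mul_smul, mul_inv]
      field_simp
  refine ⟨⟨R.toNNReal, LipschitzWith.of_le_add_mul _ fun x y => ?_⟩, hhom, convex_univ, ?_⟩
  · have h1 := hsub y (x - y)
    rw [add_sub_cancel] at h1
    rw [dist_eq_norm]
    rw [Real.coe_toNNReal _ hR]
    exact h1.trans (by linarith [hbd (x - y)])
  · intro x _ y _ a b ha hb _
    simp only [smul_eq_mul]
    rw [← hhom a ha, ← hhom b hb]
    exact hsub _ _
end erg


section det
variable {d : ℕ}

lemma line_bound_1d (w : Ed d → ℝ) (C : ℝ≥0) (hw : LipschitzWith C w) (a v : Ed d) (c : ℝ)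
    (h : ∀ᵐ t : ℝ, t ∈ Set.Icc (0:ℝ) 1 → DifferentiableAt ℝ w (a + t • v) ∧
      ⟪gradient w (a + t • v), v⟫ ≤ c) : w (a + v) - w a ≤ c := by
  set f : ℝ → ℝ := fun t => w (a + t • v) with hf
  have hlip : LipschitzWith (C * ‖v‖₊) f := by
    refine hw.comp (LipschitzWith.of_dist_le_mul fun s t => ?_)
    rw [dist_add_left, dist_eq_norm, ← sub_smul, norm_smul, dist_eq_norm, mul_comm]; rfl
  have hac : AbsolutelyContinuousOnInterval f 0 1 :=
    (hlip.lipschitzOnWith).absolutelyContinuousOnInterval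
  have h1 := hac.integral_deriv_eq_sub
  have h2 : ∫ t in (0:ℝ)..1, deriv f t ≤ ∫ t in (0:ℝ)..1, c := by
    refine intervalIntegral.integral_mono_ae_restrict zero_le_one hac.intervalIntegrable_deriv
      (by simp) ?_
    rw [EventuallyLE, ae_restrict_iff' measurableSet_Icc]
    filter_upwards [h] with t ht htI
    obtain ⟨hd, hle⟩ := ht htI
    have hg := hd.hasGradientAt.hasFDerivAt
    have hline : HasDerivAt (fun t : ℝ => a + t • v) v t := by
      simpa using ((hasDerivAt_id t).smul_const v).const_add a
    have := (hg.comp_hasDerivAt t hline).deriv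
    have e : deriv f t = ⟪gradient w (a + t • v), v⟫ := by
      rw [← InnerProductSpace.toDual_apply_apply (𝕜 := ℝ)]
      exact this
    rw [e]; exact hle
  rw [h1] at h2
  simpa [hf] using h2

lemma line_bound (w : Ed d → ℝ) (C : ℝ≥0) (hw : LipschitzWith C w) (a b : Ed d) (c ρ : ℝ)
    (hρ : ‖b - a‖ < ρ)
    (h : ∀ᵐ z, ‖z - a‖ < ρ → ⟪gradient w z, b - a⟫ ≤ c) : w b - w a ≤ c := by
  set v := b - a with hv
  have hG : ∀ᵐ z, DifferentiableAt ℝ w z ∧ (‖z - a‖ < ρ → ⟪gradient w z, v⟫ ≤ c) :=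
    hw.ae_differentiableAt.and h
  obtain ⟨N, hNsub, hNm, hN0⟩ := exists_measurable_superset_of_null (ae_iff.1 hG)
  have h1 : ∀ᵐ u : Ed d, ∀ᵐ t : ℝ, u + (a + t • v) ∉ N := by
    have hmeas : MeasurableSet {x : ℝ × Ed d | x.2 + (a + x.1 • v) ∉ N} := by
      have : Measurable fun x : ℝ × Ed d => x.2 + (a + x.1 • v) := by fun_prop
      exact this hNm.compl
    rw [← Measure.ae_ae_comm (p := fun (t : ℝ) (u : Ed d) => u + (a + t • v) ∉ N) hmeas]
    refine Eventually.of_forall fun t => ?_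
    have := measure_preimage_add_right (volume : Measure (Ed d)) (a + t • v) N
    rw [hN0] at this
    exact measure_eq_zero_iff_ae_notMem.1 this
  refine le_of_forall_pos_le_add fun ε hε => ?_
  set η := min (ρ - ‖v‖) (ε / (2 * (C + 1))) with hη
  have hηpos : 0 < η := lt_min (by linarith) (by positivity)
  obtain ⟨u, huη, hu⟩ : ∃ u ∈ Metric.ball (0 : Ed d) η, ∀ᵐ t : ℝ, u + (a + t • v) ∉ N :=
    (Measure.dense_of_ae h1).exists_mem_open Metric.isOpen_ball ⟨0, Metric.mem_ball_self hηpos⟩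
      |>.imp fun u hu => ⟨hu.2, hu.1⟩
  rw [mem_ball_zero_iff] at huη
  have h3 : w (u + a + v) - w (u + a) ≤ c := by
    refine line_bound_1d w C hw (u + a) v c ?_
    filter_upwards [hu] with t ht htI
    rw [← add_assoc] at ht
    have h4 : DifferentiableAt ℝ w (u + a + t • v) ∧
        (‖(u + a + t • v) - a‖ < ρ → ⟪gradient w (u + a + t • v), v⟫ ≤ c) := by
      by_contra hcon
      exact ht (hNsub hcon)
    refine ⟨h4.1, h4.2 ?_⟩
    have : (u + a + t • v) - a = u + t • v := by abel
    rw [this]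
    have h5 : ‖t • v‖ ≤ ‖v‖ := by
      rw [norm_smul, Real.norm_of_nonneg htI.1]
      exact mul_le_of_le_one_left (norm_nonneg _) htI.2
    have h6 : η ≤ ρ - ‖v‖ := min_le_left _ _
    linarith [norm_add_le u (t • v)]
  have h7 : ∀ z, |w (u + z) - w z| ≤ C * η := by
    intro z
    have := hw.dist_le_mul (u + z) z
    rw [Real.dist_eq, dist_eq_norm, add_sub_cancel_right] at this
    exact this.trans (by gcongr)
  have h8 : C * η ≤ ε / 2 := by
    calc C * η ≤ (C + 1) * (ε / (2 * (C + 1))) := by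
          gcongr
          · linarith
          · exact min_le_right _ _
      _ = ε / 2 := by field_simp
  have h9 := (abs_le.1 (h7 a)).2
  have h10 := (abs_le.1 (h7 b)).1
  have e : u + b = u + a + v := by rw [hv]; abel
  rw [e] at h10
  linarith

/-- Subsolutions of level `μ`. -/
def IsSub (h : Ed d → Ed d → ℝ) (μ : ℝ) (w : Ed d → ℝ) : Prop :=
  w ∈ LipFuns d ∧ ∀ᵐ z, h (gradient w z) z ≤ μ

lemma IsSub.mono {h : Ed d → Ed d → ℝ} {μ ν : ℝ} (hμ : μ ≤ ν) {w : Ed d → ℝ} (hw : IsSub h μ w) :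
    IsSub h ν w := ⟨hw.1, hw.2.mono fun _ hz => hz.trans hμ⟩

lemma IsSub.lip {h : Ed d → Ed d → ℝ} {μ R : ℝ} (hR : ∀ p y, h p y ≤ μ → ‖p‖ ≤ R)
    {w : Ed d → ℝ} (hw : IsSub h μ w) (x y : Ed d) : w y - w x ≤ R * ‖y - x‖ := by
  obtain ⟨⟨C, hC⟩, hae⟩ := hw
  refine line_bound w C hC x y _ (‖y - x‖ + 1) (by linarith) ?_
  filter_upwards [hae] with z hz _
  refine (real_inner_le_norm _ _).trans ?_
  gcongr
  exact hR _ _ hz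

lemma IsSub.avg {h : Ed d → Ed d → ℝ} {Λ : ℝ → ℝ → ℝ}
    (hΛmono : ∀ a b a' b' : ℝ, a ≤ a' → b ≤ b' → Λ a b ≤ Λ a' b')
    (hsqc : ∀ (p q y : Ed d), h ((1/2 : ℝ) • (p + q)) y ≤ Λ (h p y) (h q y))
    {μ ν : ℝ} {w w' : Ed d → ℝ} (hw : IsSub h μ w) (hw' : IsSub h ν w') :
    IsSub h (Λ μ ν) (fun z => (1/2 : ℝ) * (w z + w' z)) := by
  obtain ⟨⟨C, hC⟩, hae⟩ := hw
  obtain ⟨⟨C', hC'⟩, hae'⟩ := hw'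
  refine ⟨⟨_, (lipschitzWith_smul (1/2 : ℝ)).comp (hC.add hC')⟩, ?_⟩
  filter_upwards [hae, hae', hC.ae_differentiableAt, hC'.ae_differentiableAt] with z h1 h2 h3 h4
  have : HasGradientAt (fun z => (1/2 : ℝ) * (w z + w' z))
      ((1/2 : ℝ) • (gradient w z + gradient w' z)) z := by
    rw [hasGradientAt_iff_hasFDerivAt, map_smul, map_add]
    exact (h3.hasGradientAt.hasFDerivAt.add h4.hasGradientAt.hasFDerivAt).const_mul _
  rw [this.gradient]
  exact (hsqc _ _ _).trans (hΛmono _ _ _ _ h1 h2)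

lemma IsSub.tilt {h : Ed d → Ed d → ℝ} {μ ν : ℝ} (e : Ed d)
    (hmod : ∀ p y, h p y ≤ μ → h (p + e) y ≤ ν) {w : Ed d → ℝ} (hw : IsSub h μ w) :
    IsSub h ν (fun z => w z + ⟪e, z⟫) := by
  obtain ⟨⟨C, hC⟩, hae⟩ := hw
  refine ⟨⟨_, hC.add (innerSL ℝ e).lipschitz⟩, ?_⟩
  filter_upwards [hae, hC.ae_differentiableAt] with z h1 h3
  have : HasGradientAt (fun z => w z + ⟪e, z⟫) (gradient w z + e) z := by
    rw [hasGradientAt_iff_hasFDerivAt, map_add]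
    exact h3.hasGradientAt.hasFDerivAt.add (innerSL ℝ e).hasFDerivAt
  rw [this.gradient]
  exact hmod _ _ h1

lemma IsSub.shift {h h' : Ed d → Ed d → ℝ} {μ : ℝ} (z : Ed d) (hh : ∀ p y, h' p y = h p (y + z))
    {w : Ed d → ℝ} (hw : IsSub h μ w) : IsSub h' μ (fun y => w (y + z)) := by
  obtain ⟨⟨C, hC⟩, hae⟩ := hw
  refine ⟨⟨C, LipschitzWith.of_dist_le_mul fun a b => by
    simpa using hC.dist_le_mul (a + z) (b + z)⟩, ?_⟩
  have h1 : ∀ᵐ y : Ed d, h (gradient w (y + z)) (y + z) ≤ μ :=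
    (measurePreserving_add_right (volume : Measure (Ed d)) z).quasiMeasurePreserving.ae hae
  filter_upwards [h1] with y hy
  rw [hh]
  have : gradient (fun y => w (y + z)) y = gradient w (y + z) := by
    unfold gradient; rw [fderiv_comp_add_right]
  rw [this]; exact hy

lemma mMu_def (h : Ed d → Ed d → ℝ) (μ : ℝ) (y x : Ed d) :
    mMu d h μ y x = sSup {t | ∃ w, IsSub h μ w ∧ t = w y - w x} := by
  unfold mMu
  congr 1
  ext t
  constructor
  · rintro ⟨w, h1, h2, h3⟩; exact ⟨w, ⟨h1, h2⟩, h3⟩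
  · rintro ⟨w, ⟨h1, h2⟩, h3⟩; exact ⟨w, h1, h2, h3⟩

lemma le_mMu {h : Ed d → Ed d → ℝ} {μ R : ℝ} (hR : ∀ p y, h p y ≤ μ → ‖p‖ ≤ R)
    {w : Ed d → ℝ} (hw : IsSub h μ w) (y x : Ed d) : w y - w x ≤ mMu d h μ y x := by
  rw [mMu_def]
  refine le_csSup ⟨R * ‖y - x‖, ?_⟩ ⟨w, hw, rfl⟩
  rintro _ ⟨w, hw, rfl⟩
  exact hw.lip hR x y

lemma mMu_le {h : Ed d → Ed d → ℝ} {μ : ℝ} (hne : ∃ w, IsSub h μ w) {y x : Ed d} {c : ℝ}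
    (hc : ∀ w, IsSub h μ w → w y - w x ≤ c) : mMu d h μ y x ≤ c := by
  rw [mMu_def]
  refine csSup_le ?_ ?_
  · obtain ⟨w, hw⟩ := hne; exact ⟨_, w, hw, rfl⟩
  · rintro _ ⟨w, hw, rfl⟩; exact hc w hw

lemma mMu_mono {h : Ed d → Ed d → ℝ} {ν μ R : ℝ} (hR : ∀ p y, h p y ≤ μ → ‖p‖ ≤ R) (hνμ : ν ≤ μ)
    (hne : ∃ w, IsSub h ν w) (y x : Ed d) : mMu d h ν y x ≤ mMu d h μ y x :=
  mMu_le hne fun _ hw => le_mMu hR (hw.mono hνμ) y x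

lemma mMu_abs {h : Ed d → Ed d → ℝ} {μ R : ℝ} (hR : ∀ p y, h p y ≤ μ → ‖p‖ ≤ R)
    (hne : ∃ w, IsSub h μ w) (y x : Ed d) : |mMu d h μ y x| ≤ R * ‖y - x‖ := by
  rw [abs_le]
  constructor
  · obtain ⟨w, hw⟩ := hne
    have h1 := le_mMu hR hw y x
    have h2 := hw.lip hR y x
    rw [norm_sub_rev] at h2
    linarith
  · exact mMu_le hne fun w hw => hw.lip hR x y

lemma mMu_sub {h : Ed d → Ed d → ℝ} {μ R : ℝ} (hR : ∀ p y, h p y ≤ μ → ‖p‖ ≤ R)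
    (hne : ∃ w, IsSub h μ w) (x y z : Ed d) :
    mMu d h μ z x ≤ mMu d h μ z y + mMu d h μ y x :=
  mMu_le hne fun w hw => by
    have h1 := le_mMu hR hw z y
    have h2 := le_mMu hR hw y x
    linarith

lemma IsSub.shift' {h h' : Ed d → Ed d → ℝ} (z : Ed d) (hh : ∀ p y, h' p y = h p (y + z)) :
    ∀ p y, h p y = h' p (y + -z) := fun p y => by rw [hh, neg_add_cancel_right]

lemma mMu_shift {h h' : Ed d → Ed d → ℝ} {μ : ℝ} (z : Ed d) (hh : ∀ p y, h' p y = h p (y + z))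
    (y x : Ed d) : mMu d h' μ y x = mMu d h μ (y + z) (x + z) := by
  rw [mMu_def, mMu_def]
  congr 1
  ext t
  constructor
  · rintro ⟨w, hw, rfl⟩
    refine ⟨_, hw.shift (-z) (IsSub.shift' z hh), ?_⟩
    simp
  · rintro ⟨w, hw, rfl⟩
    exact ⟨_, hw.shift z hh, rfl⟩

lemma mMu_tilt {h : Ed d → Ed d → ℝ} {μ ν R ε : ℝ} (hε : 0 ≤ ε) (hR : ∀ p y, h p y ≤ ν → ‖p‖ ≤ R)
    (hmod : ∀ p e y, ‖e‖ ≤ ε → h p y ≤ μ → h (p + e) y ≤ ν) (hne : ∃ w, IsSub h μ w)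
    (y x : Ed d) : mMu d h μ y x + ε * ‖y - x‖ ≤ mMu d h ν y x := by
  rw [← le_sub_iff_add_le]
  refine mMu_le hne fun w hw => ?_
  set e : Ed d := (ε / ‖y - x‖) • (y - x) with he
  have hen : ‖e‖ ≤ ε := by
    rw [he, norm_smul, Real.norm_of_nonneg (by positivity)]
    by_cases h0 : ‖y - x‖ = 0
    · simpa [h0] using hε
    · exact (div_mul_cancel₀ _ h0).le
  have h1 := le_mMu hR (hw.tilt e fun p y => hmod p e y hen) y x
  have h2 : ⟪e, y⟫ - ⟪e, x⟫ = ε * ‖y - x‖ := by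
    rw [← inner_sub_right, he, real_inner_smul_left, real_inner_self_eq_norm_sq]
    by_cases h0 : ‖y - x‖ = 0
    · simp [h0]
    · field_simp
  linarith

/-- Iterates of `Λ`. -/
def iterΛ (Λ : ℝ → ℝ → ℝ) (ν : ℝ) : ℕ → ℝ → ℝ
  | 0, _ => ν
  | k + 1, μ => Λ μ (iterΛ Λ ν k μ)

lemma iterΛ_cont {Λ : ℝ → ℝ → ℝ} (hΛcont : Continuous fun m : ℝ × ℝ => Λ m.1 m.2) (ν : ℝ) (k : ℕ) :
    Continuous (iterΛ Λ ν k) := by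
  induction k with
  | zero => exact continuous_const
  | succ k ih => exact hΛcont.comp (continuous_id.prodMk ih)

lemma iterΛ_lt {Λ : ℝ → ℝ → ℝ} (hΛstrict : ∀ a b : ℝ, a ≠ b → Λ a b < max a b) {ν μ : ℝ}
    (h : ν < μ) (k : ℕ) : iterΛ Λ ν k μ < μ := by
  induction k with
  | zero => exact h
  | succ k ih =>
    have := hΛstrict μ _ ih.ne'
    rwa [max_eq_left ih.le] at this

lemma IsSub.iter {h : Ed d → Ed d → ℝ} {Λ : ℝ → ℝ → ℝ}
    (hΛmono : ∀ a b a' b' : ℝ, a ≤ a' → b ≤ b' → Λ a b ≤ Λ a' b')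
    (hsqc : ∀ (p q y : Ed d), h ((1/2 : ℝ) • (p + q)) y ≤ Λ (h p y) (h q y))
    {μ ν : ℝ} {w w' : Ed d → ℝ} (hw : IsSub h μ w) (hw' : IsSub h ν w') (k : ℕ) :
    IsSub h (iterΛ Λ ν k μ) (fun z => w z + (1/2 : ℝ)^k * (w' z - w z)) := by
  induction k with
  | zero => simpa [iterΛ] using hw'
  | succ k ih =>
    have := IsSub.avg hΛmono hsqc hw ih
    have e : (fun z => w z + (1/2 : ℝ)^(k+1) * (w' z - w z)) =
        fun z => 1 / 2 * (w z + (w z + (1 / 2) ^ k * (w' z - w z))) := by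
      funext z; ring
    rw [e]; exact this

/-- Quantitative continuity in the level. -/
lemma mMu_cont {Λ : ℝ → ℝ → ℝ} (hΛcont : Continuous fun m : ℝ × ℝ => Λ m.1 m.2)
    (hΛmono : ∀ a b a' b' : ℝ, a ≤ a' → b ≤ b' → Λ a b ≤ Λ a' b')
    (hΛstrict : ∀ a b : ℝ, a ≠ b → Λ a b < max a b)
    (ν μ R ε : ℝ) (hε : 0 < ε) (hνμ : ν < μ) :
    ∃ μ₁ μ₂ : ℝ, ν < μ₁ ∧ μ₁ < μ ∧ μ < μ₂ ∧ μ₂ ≤ μ + 1 ∧ ∀ (h : Ed d → Ed d → ℝ),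
      (∀ (p q y : Ed d), h ((1/2 : ℝ) • (p + q)) y ≤ Λ (h p y) (h q y)) →
      (∀ p y, h p y ≤ μ + 1 → ‖p‖ ≤ R) → (∃ w, IsSub h ν w) →
      ∀ y x, mMu d h μ₂ y x ≤ mMu d h μ₁ y x + ε * ‖y - x‖ := by
  obtain ⟨k, hk⟩ : ∃ k : ℕ, (1/2 : ℝ)^k < ε / (2 * |R| + 1) :=
    exists_pow_lt_of_lt_one (by positivity) (by norm_num)
  have h1 := iterΛ_lt hΛstrict hνμ k
  have h2 : ∀ᶠ m in 𝓝 μ, iterΛ Λ ν k m < μ :=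
    (iterΛ_cont hΛcont ν k).continuousAt.eventually_lt_const h1
  obtain ⟨δ, hδ, hδ'⟩ := Metric.eventually_nhds_iff.1 h2
  set μ₂ := μ + min (δ / 2) 1 with hμ₂
  have hmin : 0 < min (δ / 2) 1 := by positivity
  have h3 : iterΛ Λ ν k μ₂ < μ := hδ' (by
    rw [hμ₂, Real.dist_eq, add_sub_cancel_left, abs_of_pos hmin]
    linarith [min_le_left (δ / 2) 1])
  obtain ⟨μ₁, h4, h5⟩ := exists_between (max_lt h3 hνμ)
  refine ⟨μ₁, μ₂, (le_max_right _ _).trans_lt h4, h5, by linarith,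
    by linarith [min_le_right (δ / 2) 1], ?_⟩
  intro h hsqc hR ⟨w', hw'⟩ y x
  have hR2 : ∀ p y, h p y ≤ μ₂ → ‖p‖ ≤ R := fun p y hp => hR p y
    (hp.trans (by linarith [min_le_right (δ / 2) 1]))
  have hR1 : ∀ p y, h p y ≤ μ₁ → ‖p‖ ≤ R := fun p y hp => hR p y (by linarith)
  have hRν : ∀ p y, h p y ≤ ν → ‖p‖ ≤ R := fun p y hp => hR p y (by linarith)
  refine mMu_le ⟨w', hw'.mono (by linarith)⟩ fun w hw => ?_
  have h6 := (IsSub.iter hΛmono hsqc hw hw' k).mono (((le_max_left _ _).trans_lt h4).le)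
  have h7 := le_mMu hR1 h6 y x
  have h8 := hw.lip hR2 x y
  have h9 := hw'.lip hRν y x
  rw [norm_sub_rev] at h9
  have h10 : (1/2 : ℝ)^k * ((w y - w x) + (w' x - w' y)) ≤ ε * ‖y - x‖ := by
    calc (1/2 : ℝ)^k * ((w y - w x) + (w' x - w' y)) ≤ (1/2 : ℝ)^k * ((2 * |R| + 1) * ‖y - x‖) := by
          refine mul_le_mul_of_nonneg_left ?_ (by positivity)
          have : R * ‖y - x‖ ≤ |R| * ‖y - x‖ := by gcongr; exact le_abs_self R
          nlinarith [norm_nonneg (y - x)]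
      _ ≤ (ε / (2 * |R| + 1)) * ((2 * |R| + 1) * ‖y - x‖) := by gcongr
      _ = ε * ‖y - x‖ := by field_simp
  nlinarith
end det


section chains
variable {d : ℕ}

/-- A dense sequence. -/
def qs (d : ℕ) (n : ℕ) : Ed d := TopologicalSpace.denseSeq (Ed d) n

lemma qs_dense : DenseRange (qs d) := TopologicalSpace.denseRange_denseSeq (Ed d)

lemma qs_near (z : Ed d) {ε : ℝ} (hε : 0 < ε) : ∃ i, ‖qs d i - z‖ < ε := by
  obtain ⟨i, hi⟩ := qs_dense.exists_dist_lt z hε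
  exact ⟨i, by rwa [dist_comm, dist_eq_norm] at hi⟩

/-- One-step cost bound. -/
def Link (h : Ed d → Ed d → ℝ) (μ r R : ℝ) (i j : ℕ) (c : ℝ) : Prop :=
  (‖qs d j - qs d i‖ < r ∧ ∀ p, h p (qs d i) < μ → ⟪p, qs d j - qs d i⟫ ≤ c) ∨
    R * ‖qs d j - qs d i‖ ≤ c

/-- Chain cost bound. -/
def Reach (h : Ed d → Ed d → ℝ) (μ r R : ℝ) (i : ℕ) : ℕ → ℕ → ℚ → Prop
  | 0, j, c => i = j ∧ c = 0
  | n + 1, j, c => ∃ (k : ℕ) (c' : ℚ), Reach h μ r R i n k c' ∧ Link h μ r R k j ((c - c' : ℚ) : ℝ)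

lemma Link.sound {h : Ed d → Ed d → ℝ} {μ₀ μ r R : ℝ} (hR : ∀ p y, h p y ≤ μ₀ → ‖p‖ ≤ R)
    (hmod : ∀ p y y', ‖y - y'‖ < r → h p y ≤ μ₀ → h p y' < μ) {w : Ed d → ℝ} (hw : IsSub h μ₀ w)
    {i j : ℕ} {c : ℝ} (hl : Link h μ r R i j c) : w (qs d j) - w (qs d i) ≤ c := by
  rcases hl with ⟨hr, hp⟩ | hl
  · obtain ⟨⟨C, hC⟩, hae⟩ := hw
    refine line_bound w C hC _ _ _ r hr ?_
    filter_upwards [hae] with z hz hzr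
    exact hp _ (hmod _ _ _ hzr hz)
  · exact (hw.lip hR _ _).trans hl

lemma Reach.sound {h : Ed d → Ed d → ℝ} {μ₀ μ r R : ℝ} (hR : ∀ p y, h p y ≤ μ₀ → ‖p‖ ≤ R)
    (hmod : ∀ p y y', ‖y - y'‖ < r → h p y ≤ μ₀ → h p y' < μ) {w : Ed d → ℝ} (hw : IsSub h μ₀ w)
    {i : ℕ} (n : ℕ) : ∀ {j : ℕ} {c : ℚ}, Reach h μ r R i n j c → w (qs d j) - w (qs d i) ≤ c := by
  induction n with
  | zero => rintro j c ⟨rfl, rfl⟩; simp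
  | succ n ih =>
    rintro j c ⟨k, c', h1, h2⟩
    have h3 := ih h1
    have h4 := h2.sound hR hmod hw
    push_cast at h4
    linarith

lemma convex_of_mid {K : Set (Ed d)} (hK : IsClosed K)
    (hm : ∀ p ∈ K, ∀ q ∈ K, (1/2 : ℝ) • (p + q) ∈ K) : Convex ℝ K := by
  rw [convex_iff_segment_subset]
  intro x hx y hy
  rw [segment_eq_image']
  rintro _ ⟨t₀, ht₀, rfl⟩
  set S : Set ℝ := {t | x + t • (y - x) ∈ K} with hS
  have hSc : IsClosed S := hK.preimage (by fun_prop)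
  have h0 : (0:ℝ) ∈ S := by simpa [hS] using hx
  have h1 : (1:ℝ) ∈ S := by simpa [hS] using hy
  have hSm : ∀ s ∈ S, ∀ t ∈ S, (s + t) / 2 ∈ S := by
    intro s hs t ht
    have := hm _ hs _ ht
    have e : (1/2 : ℝ) • ((x + s • (y - x)) + (x + t • (y - x))) =
      x + ((s + t) / 2) • (y - x) := by module
    rw [e] at this
    exact this
  change t₀ ∈ S
  by_contra hn
  have hA : IsCompact (S ∩ Set.Icc 0 t₀) := isCompact_Icc.inter_left hSc
  have hB : IsCompact (S ∩ Set.Icc t₀ 1) := isCompact_Icc.inter_left hSc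
  obtain ⟨a, ⟨haS, ha⟩, ham⟩ := hA.exists_isGreatest ⟨0, h0, le_rfl, ht₀.1⟩
  obtain ⟨b, ⟨hbS, hb⟩, hbm⟩ := hB.exists_isLeast ⟨1, h1, ht₀.2, le_rfl⟩
  have ha' : a < t₀ := lt_of_le_of_ne ha.2 fun e => hn (e ▸ haS)
  have hb' : t₀ < b := lt_of_le_of_ne hb.1 fun e => hn (e ▸ hbS)
  have hc := hSm a haS b hbS
  rcases le_total ((a + b) / 2) t₀ with hl | hl
  · have := ham ⟨hc, by linarith [ha.1], hl⟩
    linarith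
  · have := hbm ⟨hc, hl, by linarith [hb.2]⟩
    linarith

lemma rat_above (x : ℝ) {ε : ℝ} (hε : 0 < ε) : ∃ c : ℚ, x ≤ c ∧ (c : ℝ) < x + ε := by
  obtain ⟨c, h1, h2⟩ := exists_rat_btwn (show x < x + ε by linarith)
  exact ⟨c, h1.le, h2⟩

lemma Link.mono {h : Ed d → Ed d → ℝ} {μ r R : ℝ} {i j : ℕ} {c c' : ℝ} (hc : c ≤ c')
    (hl : Link h μ r R i j c) : Link h μ r R i j c' := by
  rcases hl with ⟨hr, hp⟩ | hl
  · exact Or.inl ⟨hr, fun p hp' => (hp p hp').trans hc⟩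
  · exact Or.inr (hl.trans hc)

/-- The set whose infimum is the chain potential. -/
def chainSet (h : Ed d → Ed d → ℝ) (μ r R : ℝ) (i : ℕ) (x : Ed d) : Set ℝ :=
  {t | ∃ (n j : ℕ) (c : ℚ), Reach h μ r R i n j c ∧ t = c + R * ‖x - qs d j‖}

/-- The chain potential. -/
def chainPot (h : Ed d → Ed d → ℝ) (μ r R : ℝ) (i : ℕ) (x : Ed d) : ℝ :=
  sInf (chainSet h μ r R i x)

lemma chainSet_ne (h : Ed d → Ed d → ℝ) (μ r R : ℝ) (i : ℕ) (x : Ed d) :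
    (chainSet h μ r R i x).Nonempty := ⟨_, 0, i, 0, ⟨rfl, rfl⟩, rfl⟩

lemma chainSet_bdd {h : Ed d → Ed d → ℝ} {μ r R : ℝ} (hR0 : 0 ≤ R) {i : ℕ}
    (hpos : ∀ n c, Reach h μ r R i n i c → 0 ≤ c) (x : Ed d) :
    BddBelow (chainSet h μ r R i x) := by
  refine ⟨-1 - R * ‖x - qs d i‖, ?_⟩
  rintro _ ⟨n, j, c, hc, rfl⟩
  obtain ⟨c₂, h1, h2⟩ := rat_above (R * ‖qs d i - qs d j‖) one_pos
  have h3 := hpos (n + 1) (c + c₂) ⟨j, c, hc, Or.inr (by rw [add_sub_cancel_left]; exact h1)⟩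
  have h3' : (0:ℝ) ≤ c + c₂ := by exact_mod_cast h3
  have h4 : R * ‖qs d i - qs d j‖ ≤ R * (‖x - qs d i‖ + ‖x - qs d j‖) := by
    gcongr
    have : qs d i - qs d j = (x - qs d j) - (x - qs d i) := by abel
    rw [this]
    linarith [norm_sub_le (x - qs d j) (x - qs d i)]
  linarith

section pot

lemma chainPot_lip {h : Ed d → Ed d → ℝ} {μ r R : ℝ} {i : ℕ} (hR0 : 0 ≤ R)
    (hpos : ∀ n c, Reach h μ r R i n i c → 0 ≤ c)
    (x y : Ed d) :
    chainPot h μ r R i y - chainPot h μ r R i x ≤ R * ‖y - x‖ := by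
  rw [sub_le_iff_le_add, add_comm, ← sub_le_iff_le_add]
  refine le_csInf (chainSet_ne _ _ _ _ _ _) ?_
  rintro _ ⟨n, j, c, hc, rfl⟩
  rw [sub_le_iff_le_add]
  refine (csInf_le (chainSet_bdd hR0 hpos y) ⟨n, j, c, hc, rfl⟩).trans ?_
  have : R * ‖y - qs d j‖ ≤ R * (‖y - x‖ + ‖x - qs d j‖) := by
    gcongr
    have := norm_add_le (y - x) (x - qs d j)
    rwa [sub_add_sub_cancel] at this
  linarith

lemma chainPot_exists {h : Ed d → Ed d → ℝ} {μ r R : ℝ} {i : ℕ} (hR0 : 0 ≤ R)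
    (hpos : ∀ n c, Reach h μ r R i n i c → 0 ≤ c)
    (j : ℕ) {ε : ℝ} (hε : 0 < ε) :
    ∃ n c, Reach h μ r R i n j c ∧ (c : ℝ) < chainPot h μ r R i (qs d j) + ε := by
  obtain ⟨_, ⟨n, k, c, hc, rfl⟩, hlt⟩ := exists_lt_of_csInf_lt (chainSet_ne h μ r R i (qs d j))
    (show chainPot h μ r R i (qs d j) < chainPot h μ r R i (qs d j) + ε / 2 by linarith)
  obtain ⟨c₂, h1, h2⟩ := rat_above (R * ‖qs d j - qs d k‖) (half_pos hε)
  refine ⟨n + 1, c + c₂, ⟨k, c, hc, Or.inr (by rw [add_sub_cancel_left]; exact h1)⟩, ?_⟩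
  push_cast
  linarith

lemma chainPot_le {h : Ed d → Ed d → ℝ} {μ r R : ℝ} {i : ℕ} (hR0 : 0 ≤ R)
    (hpos : ∀ n c, Reach h μ r R i n i c → 0 ≤ c)
    {n j : ℕ} {c : ℚ} (hc : Reach h μ r R i n j c) :
    chainPot h μ r R i (qs d j) ≤ c :=
  csInf_le (chainSet_bdd hR0 hpos _) ⟨n, j, c, hc, by simp⟩

lemma chainPot_link {h : Ed d → Ed d → ℝ} {μ r R : ℝ} {i : ℕ} (hR0 : 0 ≤ R)
    (hpos : ∀ n c, Reach h μ r R i n i c → 0 ≤ c)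
    {j k : ℕ} {u : ℝ} (hl : Link h μ r R j k u) :
    chainPot h μ r R i (qs d k) ≤ chainPot h μ r R i (qs d j) + u := by
  refine le_of_forall_pos_le_add fun ε hε => ?_
  obtain ⟨n, c, hc, hlt⟩ := chainPot_exists hR0 hpos j (half_pos hε)
  obtain ⟨c₂, h1, h2⟩ := rat_above u (half_pos hε)
  have := chainPot_le hR0 hpos (n := n + 1) (j := k) (c := c + c₂)
    ⟨j, c, hc, by rw [add_sub_cancel_left]; exact hl.mono h1⟩
  push_cast at this
  linarith

lemma chainPot_dir {h : Ed d → Ed d → ℝ} {μ r R : ℝ} {i : ℕ} (hR0 : 0 ≤ R)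
    (hpos : ∀ n c, Reach h μ r R i n i c → 0 ≤ c)
    (hr : 0 < r) (hRl : ∀ p y, h p y < μ → ‖p‖ ≤ R) {μ' ρ : ℝ}
    (hρ : 0 < ρ) (hmod : ∀ p y y', ‖y - y'‖ < ρ → h p y < μ → h p y' ≤ μ') (z e : Ed d) {u : ℝ}
    (hu : ∀ q, h q z ≤ μ' → ⟪q, e⟫ ≤ u) {t : ℝ} (ht : 0 ≤ t) (htr : ‖t • e‖ < r) :
    chainPot h μ r R i (z + t • e) - chainPot h μ r R i z ≤ t * u := by
  refine le_of_forall_pos_le_add fun ε hε => ?_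
  set η := min (min (ρ / 2) ((r - ‖t • e‖) / 2)) (ε / (4 * (R + 1))) with hη
  have hηpos : 0 < η := lt_min (lt_min (by linarith) (by linarith)) (by positivity)
  have hη1 : η ≤ ρ / 2 := (min_le_left _ _).trans (min_le_left _ _)
  have hη2 : η ≤ (r - ‖t • e‖) / 2 := (min_le_left _ _).trans (min_le_right _ _)
  have hη3 : (R + 1) * η ≤ ε / 4 := by
    calc (R + 1) * η ≤ (R + 1) * (ε / (4 * (R + 1))) := by gcongr; exact min_le_right _ _
      _ = ε / 4 := by field_simp
  obtain ⟨j, hj⟩ := qs_near z hηpos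
  obtain ⟨k, hk⟩ := qs_near (z + t • e) hηpos
  have herr : ‖(qs d k - qs d j) - t • e‖ ≤ 2 * η := by
    have e1 : (qs d k - qs d j) - t • e = (qs d k - (z + t • e)) - (qs d j - z) := by abel
    rw [e1]
    linarith [norm_sub_le (qs d k - (z + t • e)) (qs d j - z)]
  have hl : Link h μ r R j k (t * u + R * (2 * η)) := by
    left
    constructor
    · have := norm_add_le ((qs d k - qs d j) - t • e) (t • e)
      rw [sub_add_cancel] at this
      by_cases h0 : ‖qs d k - qs d j‖ < r
      · exact h0
      · have e1 : qs d k - qs d j = (qs d k - (z + t • e)) - (qs d j - z) + t • e := by abel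
        have := norm_add_le ((qs d k - (z + t • e)) - (qs d j - z)) (t • e)
        rw [← e1] at this
        linarith [norm_sub_le (qs d k - (z + t • e)) (qs d j - z)]
    · intro p hp
      have h1 : h p z ≤ μ' := hmod p _ z (by linarith) hp
      have h2 := hu p h1
      have h3 : ⟪p, qs d k - qs d j⟫ = t * ⟪p, e⟫ + ⟪p, (qs d k - qs d j) - t • e⟫ := by
        rw [inner_sub_right p (qs d k - qs d j), real_inner_smul_right]; ring
      rw [h3]
      have h4 : ⟪p, (qs d k - qs d j) - t • e⟫ ≤ R * (2 * η) :=
        (real_inner_le_norm _ _).trans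
          (mul_le_mul (hRl p _ hp) herr (norm_nonneg _) hR0)
      have h5 : t * ⟪p, e⟫ ≤ t * u := mul_le_mul_of_nonneg_left h2 ht
      linarith
  have h6 := chainPot_link hR0 hpos hl
  have h7 := chainPot_lip hR0 hpos z (qs d j)
  have h8 := chainPot_lip hR0 hpos (qs d k) (z + t • e)
  rw [norm_sub_rev] at h8
  have h9 : R * ‖qs d j - z‖ ≤ R * η := by gcongr
  have h10 : R * ‖qs d k - (z + t • e)‖ ≤ R * η := by gcongr
  nlinarith

lemma chainPot_isSub {h : Ed d → Ed d → ℝ} {μ r R : ℝ} {i : ℕ} (hR0 : 0 ≤ R)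
    (hpos : ∀ n c, Reach h μ r R i n i c → 0 ≤ c)
    (hr : 0 < r) (hcont : Continuous fun q : Ed d × Ed d => h q.1 q.2)
    (hqc : ∀ p q y, h ((1/2 : ℝ) • (p + q)) y ≤ max (h p y) (h q y))
    (hRl : ∀ p y, h p y < μ → ‖p‖ ≤ R)
    (hmod : ∀ μ' > μ, ∃ ρ > 0, ∀ p y y', ‖y - y'‖ < ρ → h p y < μ → h p y' ≤ μ') :
    IsSub h μ (chainPot h μ r R i) := by
  have hlip : LipschitzWith ⟨R, hR0⟩ (chainPot h μ r R i) :=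
    LipschitzWith.of_dist_le_mul fun x y => by
      rw [Real.dist_eq, dist_eq_norm, abs_le]
      constructor
      · have := chainPot_lip hR0 hpos x y
        rw [norm_sub_rev] at this
        change -(R * ‖x - y‖) ≤ _
        linarith
      · exact chainPot_lip hR0 hpos y x
  refine ⟨⟨_, hlip⟩, ?_⟩
  filter_upwards [hlip.ae_differentiableAt] with z hz
  by_contra hcon
  rw [not_le] at hcon
  obtain ⟨μ', h1, h2⟩ := exists_between hcon
  obtain ⟨ρ, hρ, hmodρ⟩ := hmod μ' h1
  set p := gradient (chainPot h μ r R i) z with hp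
  have hcz : Continuous fun q => h q z := hcont.comp (continuous_id.prodMk continuous_const)
  have hKc : IsClosed {q | h q z ≤ μ'} := isClosed_le hcz continuous_const
  have hKconv : Convex ℝ {q | h q z ≤ μ'} := convex_of_mid hKc fun a ha b hb =>
    (hqc a b z).trans (max_le ha hb)
  obtain ⟨f, u, hf1, hf2⟩ := geometric_hahn_banach_closed_point hKconv hKc (x := p) (not_le.2 h2)
  set e := (InnerProductSpace.toDual ℝ (Ed d)).symm f with he
  have hfe : ∀ q, f q = ⟪q, e⟫ := fun q => by
    rw [real_inner_comm, he, InnerProductSpace.toDual_symm_apply]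
  have hder : HasDerivAt (fun t : ℝ => chainPot h μ r R i (z + t • e)) ⟪p, e⟫ 0 := by
    have hline : HasDerivAt (fun t : ℝ => z + t • e) e 0 := by
      simpa using ((hasDerivAt_id (0:ℝ)).smul_const e).const_add z
    have hg : HasFDerivAt (chainPot h μ r R i) (InnerProductSpace.toDual ℝ (Ed d) p)
      (z + (0:ℝ) • e) := by
      rw [zero_smul, add_zero]; exact hz.hasGradientAt.hasFDerivAt
    have := hg.comp_hasDerivAt 0 hline
    rwa [InnerProductSpace.toDual_apply_apply] at this
  have hslope := hder.tendsto_slope_zero_right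
  have hle : ∀ᶠ t in 𝓝[>] (0:ℝ), t⁻¹ • (chainPot h μ r R i (z + (0 + t) • e) -
      chainPot h μ r R i (z + (0:ℝ) • e)) ≤ u := by
    have h3 : ∀ᶠ t in 𝓝 (0:ℝ), ‖t • e‖ < r := by
      have : Continuous fun t : ℝ => ‖t • e‖ := by fun_prop
      exact this.continuousAt.eventually_lt_const (by simpa using hr)
    filter_upwards [h3.filter_mono nhdsWithin_le_nhds, self_mem_nhdsWithin] with t ht ht0
    have ht0' : 0 < t := ht0
    have := chainPot_dir hR0 hpos hr hRl hρ hmodρ z e (u := u)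
      (fun q hq => by rw [← hfe]; exact (hf1 q hq).le) ht0'.le ht
    rw [zero_add, zero_smul, add_zero, smul_eq_mul, inv_mul_le_iff₀ ht0']
    exact this
  have := le_of_tendsto hslope hle
  rw [hfe] at hf2
  linarith

/-- Summary: a subsolution nearly realizing the chain costs. -/
lemma chain_complete {h : Ed d → Ed d → ℝ} {μ r R : ℝ} {i : ℕ} (hR0 : 0 ≤ R)
    (hpos : ∀ n c, Reach h μ r R i n i c → 0 ≤ c)
    (hr : 0 < r) (hcont : Continuous fun q : Ed d × Ed d => h q.1 q.2)
    (hqc : ∀ p q y, h ((1/2 : ℝ) • (p + q)) y ≤ max (h p y) (h q y))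
    (hRl : ∀ p y, h p y < μ → ‖p‖ ≤ R)
    (hmod : ∀ μ' > μ, ∃ ρ > 0, ∀ p y y', ‖y - y'‖ < ρ → h p y < μ → h p y' ≤ μ') :
    ∃ w, IsSub h μ w ∧ ∀ j, ∀ ε > 0, ∃ n c, Reach h μ r R i n j c ∧
      (c : ℝ) < w (qs d j) - w (qs d i) + ε := by
  refine ⟨_, chainPot_isSub hR0 hpos hr hcont hqc hRl hmod, fun j ε hε => ?_⟩
  obtain ⟨n, c, hc, hlt⟩ := chainPot_exists hR0 hpos j hε
  have := chainPot_le hR0 hpos (n := 0) (j := i) (c := 0) ⟨rfl, rfl⟩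
  rw [Rat.cast_zero] at this
  exact ⟨n, c, hc, by linarith⟩
end pot

end chains


section meas
variable {d : ℕ} {Ω : Type*} [MeasurableSpace Ω] {H : Ed d → Ed d → Ω → ℝ}

lemma Link_meas (hHm : ∀ p y, Measurable (H p y))
    (hHcont : ∀ ω : Ω, Continuous fun q : Ed d × Ed d => H q.1 q.2 ω) (μ r R : ℝ) (i j : ℕ) (c : ℝ) :
    MeasurableSet {ω | Link (fun p y => H p y ω) μ r R i j c} := by
  have e : {ω | Link (fun p y => H p y ω) μ r R i j c} =
      {ω | (‖qs d j - qs d i‖ < r ∧ ∀ k, H (qs d k) (qs d i) ω < μ →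
        ⟪qs d k, qs d j - qs d i⟫ ≤ c) ∨ R * ‖qs d j - qs d i‖ ≤ c} := by
    ext ω
    refine or_congr_left (and_congr_right fun _ => ⟨fun hh k => hh _, fun hh p hp => ?_⟩)
    by_contra hcon
    rw [not_le] at hcon
    have ho : IsOpen {p : Ed d | H p (qs d i) ω < μ ∧ c < ⟪p, qs d j - qs d i⟫} := by
      have c1 : Continuous fun p : Ed d => H p (qs d i) ω :=
        (hHcont ω).comp (continuous_id.prodMk continuous_const)
      have c2 : Continuous fun p : Ed d => ⟪p, qs d j - qs d i⟫ := by fun_prop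
      exact (isOpen_lt c1 continuous_const).inter (isOpen_lt continuous_const c2)
    obtain ⟨k, hk⟩ := qs_dense.exists_mem_open ho ⟨p, hp, hcon⟩
    exact absurd (hh k hk.1) (not_le.2 hk.2)
  rw [e]
  have hm : ∀ k, MeasurableSet {ω | H (qs d k) (qs d i) ω < μ} := fun k =>
    measurableSet_lt (hHm _ _) measurable_const
  refine MeasurableSet.union (MeasurableSet.inter (MeasurableSet.const _) ?_) (MeasurableSet.const _)
  have e2 : {ω | ∀ k, H (qs d k) (qs d i) ω < μ → ⟪qs d k, qs d j - qs d i⟫ ≤ c} =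
      ⋂ k, ({ω | H (qs d k) (qs d i) ω < μ}ᶜ ∪ {_ω | ⟪qs d k, qs d j - qs d i⟫ ≤ c}) := by
    ext ω
    simp [imp_iff_not_or]
  change MeasurableSet {ω | ∀ k, H (qs d k) (qs d i) ω < μ → ⟪qs d k, qs d j - qs d i⟫ ≤ c}
  rw [e2]
  exact MeasurableSet.iInter fun k => (hm k).compl.union (MeasurableSet.const _)

lemma Reach_meas (hHm : ∀ p y, Measurable (H p y))
    (hHcont : ∀ ω : Ω, Continuous fun q : Ed d × Ed d => H q.1 q.2 ω) (μ r R : ℝ) (i n : ℕ) :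
    ∀ (j : ℕ) (c : ℚ), MeasurableSet {ω | Reach (fun p y => H p y ω) μ r R i n j c} := by
  induction n with
  | zero => intro j c; exact MeasurableSet.const _
  | succ n ih =>
    intro j c
    have e : {ω | Reach (fun p y => H p y ω) μ r R i (n + 1) j c} = ⋃ (k : ℕ) (c' : ℚ),
        {ω | Reach (fun p y => H p y ω) μ r R i n k c'} ∩
        {ω | Link (fun p y => H p y ω) μ r R k j ((c - c' : ℚ) : ℝ)} := by
      ext ω
      simp only [Set.mem_iUnion]
      rfl
    rw [e]
    exact MeasurableSet.iUnion fun k => MeasurableSet.iUnion fun c' =>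
      (ih k c').inter (Link_meas hHm hHcont _ _ _ _ _ _)

/-- Environments having a subsolution strictly below level `μ`. -/
def goodG (H : Ed d → Ed d → Ω → ℝ) (μ : ℝ) : Set Ω :=
  {ω | ∃ ν < μ, ∃ w, IsSub (fun p y => H p y ω) ν w}

/-- The truncated metric. -/
def Ftr (H : Ed d → Ed d → Ω → ℝ) (μ : ℝ) (y x : Ed d) : Ω → ℝ :=
  (goodG H μ).indicator fun ω => mMu d (fun p y => H p y ω) μ y x

section

lemma goodG_meas {μ R : ℝ} (hHm : ∀ p y, Measurable (H p y))
    (hHcont : ∀ ω : Ω, Continuous fun q : Ed d × Ed d => H q.1 q.2 ω)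
    (hqc : ∀ (ω : Ω) (p q y : Ed d), H ((1/2 : ℝ) • (p + q)) y ω ≤ max (H p y ω) (H q y ω))
    (hR0 : 0 ≤ R) (hR : ∀ ω p y, H p y ω ≤ μ + 1 → ‖p‖ ≤ R)
    (huc : ∀ ε > 0, ∃ δ > 0, ∀ (ω : Ω) (p y y' : Ed d), ‖p‖ ≤ R → ‖y - y'‖ < δ →
      |H p y ω - H p y' ω| < ε)
    : MeasurableSet (goodG H μ) := by
  choose r hr0 hr using fun n : ℕ => huc (1 / ((n : ℝ) + 1)) (by positivity)
  have e : goodG H μ = ⋃ n : ℕ, ⋂ (k : ℕ) (c : ℚ),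
      ({ω | Reach (fun p y => H p y ω) (μ - 1 / ((n : ℝ) + 1)) (r n) R 0 k 0 c}ᶜ ∪
        {_ω | 0 ≤ c}) := by
    ext ω
    simp only [Set.mem_iUnion, Set.mem_iInter]
    constructor
    · rintro ⟨ν, hν, w, hw⟩
      obtain ⟨n, hn⟩ := exists_nat_one_div_lt (show 0 < (μ - ν) / 2 by linarith)
      refine ⟨n, fun k c => ?_⟩
      by_cases hc : Reach (fun p y => H p y ω) (μ - 1 / ((n : ℝ) + 1)) (r n) R 0 k 0 c
      · right
        have := Reach.sound (μ₀ := ν) (fun p y hp => hR ω p y (by linarith)) ?_ hw k hc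
        · rw [sub_self] at this; exact_mod_cast this
        · intro p y y' hy hp
          have := (abs_lt.1 (hr n ω p y y' (hR ω p y (by linarith)) hy)).1
          linarith
      · left; exact hc
    · rintro ⟨n, hn⟩
      have hpos : 0 < 1 / ((n : ℝ) + 1) := by positivity
      refine ⟨μ - 1 / ((n : ℝ) + 1), by linarith, ?_⟩
      obtain ⟨w, hw, -⟩ := chain_complete (h := fun p y => H p y ω) (i := 0) hR0
        (fun k c hc => (hn k c).resolve_left fun hh => hh hc) (hr0 n) (hHcont ω) (hqc ω)
        (fun p y hp => hR ω p y (by linarith)) (by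
          intro μ' hμ'
          obtain ⟨δ, hδ, hδ'⟩ := huc (μ' - (μ - 1 / ((n : ℝ) + 1))) (by linarith)
          refine ⟨δ, hδ, fun p y y' hy hp => ?_⟩
          have := (abs_lt.1 (hδ' ω p y y' (hR ω p y (by linarith)) hy)).1
          linarith)
      exact ⟨w, hw⟩
  rw [e]
  exact MeasurableSet.iUnion fun n => MeasurableSet.iInter fun k => MeasurableSet.iInter fun c =>
    (Reach_meas hHm hHcont _ _ _ _ _ _ _).compl.union (MeasurableSet.const _)


lemma Ftr_meas_dense {μ R : ℝ} (hHm : ∀ p y, Measurable (H p y))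
    (hHcont : ∀ ω : Ω, Continuous fun q : Ed d × Ed d => H q.1 q.2 ω)
    (hqc : ∀ (ω : Ω) (p q y : Ed d), H ((1/2 : ℝ) • (p + q)) y ω ≤ max (H p y ω) (H q y ω))
    (hR0 : 0 ≤ R) (hR : ∀ ω p y, H p y ω ≤ μ + 1 → ‖p‖ ≤ R)
    (huc : ∀ ε > 0, ∃ δ > 0, ∀ (ω : Ω) (p y y' : Ed d), ‖p‖ ≤ R → ‖y - y'‖ < δ →
      |H p y ω - H p y' ω| < ε)
    {Λ : ℝ → ℝ → ℝ} (hΛcont : Continuous fun m : ℝ × ℝ => Λ m.1 m.2)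
    (hΛmono : ∀ a b a' b' : ℝ, a ≤ a' → b ≤ b' → Λ a b ≤ Λ a' b')
    (hΛstrict : ∀ a b : ℝ, a ≠ b → Λ a b < max a b)
    (hsqc : ∀ (ω : Ω) (p q y : Ed d), H ((1/2 : ℝ) • (p + q)) y ω ≤ Λ (H p y ω) (H q y ω))
    (i j : ℕ) : Measurable (Ftr H μ (qs d j) (qs d i)) := by
  choose r hr0 hr using fun n : ℕ => huc (1 / ((n : ℝ) + 1)) (by positivity)
  have hG := goodG_meas hHm hHcont hqc hR0 hR huc
  refine measurable_of_Iio fun a => ?_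
  have key : ∀ ω ∈ goodG H μ, (mMu d (fun p y => H p y ω) μ (qs d j) (qs d i) < a ↔
      ω ∈ ⋃ (n : ℕ) (k : ℕ) (c : ℚ),
        ({ω | Reach (fun p y => H p y ω) (μ + 1 / ((n : ℝ) + 1)) (r n) R i k j c} ∩
          {_ω | (c : ℝ) < a})) := by
    rintro ω ⟨ν, hν, w₀, hw₀⟩
    have hne : ∃ w, IsSub (fun p y => H p y ω) μ w := ⟨w₀, hw₀.mono hν.le⟩
    have hsound : ∀ (n k i j : ℕ) (c : ℚ) w, IsSub (fun p y => H p y ω) μ w →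
        Reach (fun p y => H p y ω) (μ + 1 / ((n : ℝ) + 1)) (r n) R i k j c →
        w (qs d j) - w (qs d i) ≤ c := by
      intro n k i j c w hw hc
      refine Reach.sound (μ₀ := μ) (fun p y hp => hR ω p y (by linarith)) ?_ hw k hc
      intro p y y' hy hp
      have := (abs_lt.1 (hr n ω p y y' (hR ω p y (by linarith)) hy)).1
      linarith
    simp only [Set.mem_iUnion]
    constructor
    · intro ha
      set m := mMu d (fun p y => H p y ω) μ (qs d j) (qs d i) with hm
      set ε := (a - m) / (2 * (‖qs d j - qs d i‖ + 1)) with hε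
      have hεpos : 0 < ε := div_pos (by linarith) (by positivity)
      have hε' : ε * ‖qs d j - qs d i‖ ≤ (a - m) / 2 := by
        calc ε * ‖qs d j - qs d i‖ ≤ ε * (‖qs d j - qs d i‖ + 1) := by gcongr; linarith
          _ = (a - m) / 2 := by rw [hε]; field_simp
      obtain ⟨μ₁, μ₂, h1, h2, h3, h3', h4⟩ := mMu_cont (d := d) hΛcont hΛmono hΛstrict ν μ R ε hεpos hν
      have h5 := h4 _ (hsqc ω) (hR ω) ⟨w₀, hw₀⟩ (qs d j) (qs d i)
      obtain ⟨n, hn⟩ := exists_nat_one_div_lt (show 0 < min (μ₂ - μ) 1 by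
        exact lt_min (by linarith) one_pos)
      have hn1 := hn.trans_le (min_le_left _ _)
      have hn2 := hn.trans_le (min_le_right _ _)
      have hpos : 0 < 1 / ((n : ℝ) + 1) := by positivity
      obtain ⟨w, hw, hw2⟩ := chain_complete (h := fun p y => H p y ω) (i := i) (r := r n)
        (μ := μ + 1 / ((n : ℝ) + 1)) hR0
        (fun k c hc => by
          obtain ⟨w, hw⟩ := hne
          have := hsound n k i i c w hw hc
          rw [sub_self] at this; exact_mod_cast this)
        (hr0 n) (hHcont ω) (hqc ω)
        (fun p y hp => hR ω p y (by linarith)) (by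
          intro μ' hμ'
          obtain ⟨δ, hδ, hδ'⟩ := huc (μ' - (μ + 1 / ((n : ℝ) + 1))) (by linarith)
          refine ⟨δ, hδ, fun p y y' hy hp => ?_⟩
          have := (abs_lt.1 (hδ' ω p y y' (hR ω p y (by linarith)) hy)).1
          linarith)
      obtain ⟨k, c, hc, hlt⟩ := hw2 j ((a - m) / 2) (by linarith)
      refine ⟨n, k, c, hc, ?_⟩
      have h6 := le_mMu (μ := μ₂) (fun p y hp => hR ω p y (by linarith))
        (hw.mono (by linarith)) (qs d j) (qs d i)
      have h7 := mMu_mono (ν := μ₁) (μ := μ) (fun p y hp => hR ω p y (by linarith)) h2.le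
        ⟨w₀, hw₀.mono h1.le⟩ (qs d j) (qs d i)
      change (c : ℝ) < a
      linarith
    · rintro ⟨n, k, c, hc, hca⟩
      exact (mMu_le hne fun w hw => hsound n k i j c w hw hc).trans_lt hca
  have hU : MeasurableSet (⋃ (n : ℕ) (k : ℕ) (c : ℚ),
        ({ω | Reach (fun p y => H p y ω) (μ + 1 / ((n : ℝ) + 1)) (r n) R i k j c} ∩
          {_ω | (c : ℝ) < a})) :=
    MeasurableSet.iUnion fun n => MeasurableSet.iUnion fun k => MeasurableSet.iUnion fun c =>
      (Reach_meas hHm hHcont _ _ _ _ _ _ _).inter (MeasurableSet.const _)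
  have e : Ftr H μ (qs d j) (qs d i) ⁻¹' Set.Iio a = (goodG H μ ∩ ⋃ (n : ℕ) (k : ℕ) (c : ℚ),
        ({ω | Reach (fun p y => H p y ω) (μ + 1 / ((n : ℝ) + 1)) (r n) R i k j c} ∩
          {_ω | (c : ℝ) < a})) ∪ ((goodG H μ)ᶜ ∩ {_ω | 0 < a}) := by
    ext ω
    by_cases hω : ω ∈ goodG H μ
    · have := key ω hω
      simp only [Set.mem_preimage, Set.mem_Iio, Ftr, Set.indicator_of_mem hω]
      rw [this]
      constructor
      · intro h; exact Or.inl ⟨hω, h⟩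
      · rintro (h | h)
        · exact h.2
        · exact absurd hω h.1
    · simp only [Set.mem_preimage, Set.mem_Iio, Ftr, Set.indicator_of_notMem hω]
      constructor
      · intro h; exact Or.inr ⟨hω, h⟩
      · rintro (h | h)
        · exact absurd h.1 hω
        · exact h.2
  rw [e]
  exact (hG.inter hU).union (hG.compl.inter (MeasurableSet.const _))

lemma Ftr_ergF {μ R : ℝ} (hHm : ∀ p y, Measurable (H p y))
    (hHcont : ∀ ω : Ω, Continuous fun q : Ed d × Ed d => H q.1 q.2 ω)
    (hqc : ∀ (ω : Ω) (p q y : Ed d), H ((1/2 : ℝ) • (p + q)) y ω ≤ max (H p y ω) (H q y ω))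
    (hR0 : 0 ≤ R) (hR : ∀ ω p y, H p y ω ≤ μ + 1 → ‖p‖ ≤ R)
    (huc : ∀ ε > 0, ∃ δ > 0, ∀ (ω : Ω) (p y y' : Ed d), ‖p‖ ≤ R → ‖y - y'‖ < δ →
      |H p y ω - H p y' ω| < ε)
    {Λ : ℝ → ℝ → ℝ} (hΛcont : Continuous fun m : ℝ × ℝ => Λ m.1 m.2)
    (hΛmono : ∀ a b a' b' : ℝ, a ≤ a' → b ≤ b' → Λ a b ≤ Λ a' b')
    (hΛstrict : ∀ a b : ℝ, a ≠ b → Λ a b < max a b)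
    (hsqc : ∀ (ω : Ω) (p q y : Ed d), H ((1/2 : ℝ) • (p + q)) y ω ≤ Λ (H p y ω) (H q y ω))
    {τ : Ed d → Ω → Ω}
    (hτgrp : ∀ x y : Ed d, τ (x + y) = τ x ∘ τ y) (hτzero : τ 0 = id)
    (hHstat : ∀ (p y z : Ed d) (ω : Ω), H p y (τ z ω) = H p (y + z) ω) :
    ErgF d τ (Ftr H μ) R := by
  have hinv1 : ∀ z ω, ω ∈ goodG H μ → τ z ω ∈ goodG H μ := by
    rintro z ω ⟨ν, hν, w, hw⟩
    exact ⟨ν, hν, _, hw.shift z fun p y => hHstat p y z ω⟩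
  have hinv : ∀ z ω, τ z ω ∈ goodG H μ ↔ ω ∈ goodG H μ := by
    intro z ω
    refine ⟨fun hh => ?_, hinv1 z ω⟩
    have h1 := hinv1 (-z) _ hh
    have h2 : τ (-z) (τ z ω) = ω := by
      have := congrFun (hτgrp (-z) z) ω
      rw [neg_add_cancel, hτzero] at this
      exact this.symm
    rwa [h2] at h1
  have hR' : ∀ ω p y, H p y ω ≤ μ → ‖p‖ ≤ R := fun ω p y hp => hR ω p y (by linarith)
  have hne : ∀ ω ∈ goodG H μ, ∃ w, IsSub (fun p y => H p y ω) μ w := by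
    rintro ω ⟨ν, hν, w, hw⟩
    exact ⟨w, hw.mono hν.le⟩
  have hsub : ∀ x y z ω, Ftr H μ z x ω ≤ Ftr H μ z y ω + Ftr H μ y x ω := by
    intro x y z ω
    by_cases hω : ω ∈ goodG H μ
    · simp only [Ftr, Set.indicator_of_mem hω]
      exact mMu_sub (hR' ω) (hne ω hω) x y z
    · simp [Ftr, Set.indicator_of_notMem hω]
  have hbd : ∀ y x ω, |Ftr H μ y x ω| ≤ R * ‖y - x‖ := by
    intro y x ω
    by_cases hω : ω ∈ goodG H μ
    · simp only [Ftr, Set.indicator_of_mem hω]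
      exact mMu_abs (hR' ω) (hne ω hω) y x
    · simp only [Ftr, Set.indicator_of_notMem hω, abs_zero]
      positivity
  refine ⟨?_, ?_, hsub, hbd⟩
  · intro y x
    choose a ha using fun n : ℕ => qs_near y (ε := 1 / ((n : ℝ) + 1)) (by positivity)
    choose b hb using fun n : ℕ => qs_near x (ε := 1 / ((n : ℝ) + 1)) (by positivity)
    refine measurable_of_tendsto_metrizable (f := fun n => Ftr H μ (qs d (a n)) (qs d (b n)))
      (fun n => Ftr_meas_dense hHm hHcont hqc hR0 hR huc hΛcont hΛmono hΛstrict hsqc _ _) ?_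
    rw [tendsto_pi_nhds]
    intro ω
    have hlim : Tendsto (fun n : ℕ => R * (1 / ((n : ℝ) + 1) + 1 / ((n : ℝ) + 1))) atTop (𝓝 0) := by
      have := (tendsto_one_div_add_atTop_nhds_zero_nat (𝕜 := ℝ))
      simpa using (this.add this).const_mul R
    rw [tendsto_iff_dist_tendsto_zero]
    refine squeeze_zero (fun _ => dist_nonneg) (fun n => ?_) hlim
    have h1 := hsub (qs d (b n)) x (qs d (a n)) ω
    have h2 := hsub x y (qs d (a n)) ω
    have h2' := hsub (qs d (b n)) x y ω
    have h3 := hsub x (qs d (b n)) y ω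
    have h4 := hsub (qs d (b n)) (qs d (a n)) y ω
    have h5 := hsub (qs d (b n)) y (qs d (a n)) ω
    have b1 := abs_le.1 (hbd (qs d (a n)) y ω)
    have b2 := abs_le.1 (hbd y (qs d (a n)) ω)
    have b3 := abs_le.1 (hbd (qs d (b n)) x ω)
    have b4 := abs_le.1 (hbd x (qs d (b n)) ω)
    rw [norm_sub_rev y] at b2
    rw [norm_sub_rev x] at b4
    have c1 : R * ‖qs d (a n) - y‖ ≤ R * (1 / ((n : ℝ) + 1)) := by gcongr; exact (ha n).le
    have c2 : R * ‖qs d (b n) - x‖ ≤ R * (1 / ((n : ℝ) + 1)) := by gcongr; exact (hb n).le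
    rw [Real.dist_eq, abs_le, mul_add]
    constructor <;> linarith
  · intro y x z ω
    by_cases hω : ω ∈ goodG H μ
    · have hω' := (hinv z ω).2 hω
      simp only [Ftr, Set.indicator_of_mem hω, Set.indicator_of_mem hω']
      exact mMu_shift z (fun p y => hHstat p y z ω) y x
    · have hω' := fun hh => hω ((hinv z ω).1 hh)
      simp only [Ftr, Set.indicator_of_notMem hω, Set.indicator_of_notMem hω']

end

lemma exists_isSub {H : Ed d → Ed d → ℝ}
    (hreg_bdd : ∀ R : ℝ, 0 < R → ∃ M : ℝ, ∀ (p y : Ed d), ‖p‖ ≤ R → |H p y| ≤ M)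
    {ν : ℝ} (hν : sInf {t | ∃ w ∈ LipFuns d, t = essSup (fun y => H (gradient w y) y) volume} < ν) :
    ∃ w, IsSub H ν w := by
  have hne : {t | ∃ w ∈ LipFuns d, t = essSup (fun y => H (gradient w y) y) volume}.Nonempty :=
    ⟨_, (fun _ => 0), ⟨0, LipschitzWith.const 0⟩, rfl⟩
  obtain ⟨_, ⟨w, hw, rfl⟩, hlt⟩ := exists_lt_of_csInf_lt hne hν
  refine ⟨w, hw, ?_⟩
  obtain ⟨C, hC⟩ := hw
  obtain ⟨M, hM⟩ := hreg_bdd (C + 1) (by positivity)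
  have hb : ∀ y, |H (gradient w y) y| ≤ M := by
    intro y
    refine hM _ _ ?_
    have : ‖gradient w y‖ = ‖fderiv ℝ w y‖ := by
      unfold gradient; simp
    rw [this]
    have := norm_fderiv_le_of_lipschitz ℝ hC (x₀ := y)
    linarith
  have := ae_le_essSup (μ := (volume : Measure (Ed d))) (f := fun y => H (gradient w y) y)
    ⟨M, eventually_map.2 (Eventually.of_forall fun y => (abs_le.1 (hb y)).2)⟩
  filter_upwards [this] with z hz
  exact hz.trans hlt.le

end meas


/-- homogenization of the metric problem via the subadditive ergodic theorem. -/
theorem statement_13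
    (d : ℕ) (hd : 0 < d)
    {Ω : Type*} [MeasurableSpace Ω] (P : Measure Ω) [IsProbabilityMeasure P]
    (τ : Ed d → Ω → Ω)
    (hτmeas : ∀ y : Ed d, Measurable (τ y))
    (hτmp : ∀ y : Ed d, MeasurePreserving (τ y) P P)
    (hτgrp : ∀ x y : Ed d, τ (x + y) = τ x ∘ τ y)
    (hτzero : τ 0 = id)
    (hτerg : ∀ A : Set Ω, MeasurableSet A → (∀ z : Ed d, τ z ⁻¹' A = A) → P A = 0 ∨ P A = 1)
    (H : Ed d → Ed d → Ω → ℝ)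
    (hHmeas : Measurable fun x : Ed d × Ed d × Ω => H x.1 x.2.1 x.2.2)
    (hHstat : ∀ (p y z : Ed d) (ω : Ω), H p y (τ z ω) = H p (y + z) ω)
    (hHcont : ∀ ω : Ω, Continuous fun q : Ed d × Ed d => H q.1 q.2 ω)
    (hreg_bdd : ∀ R : ℝ, 0 < R → ∃ M : ℝ, ∀ (ω : Ω) (p y : Ed d), ‖p‖ ≤ R → |H p y ω| ≤ M)
    (hreg_uc : ∀ R : ℝ, 0 < R → ∀ ε : ℝ, 0 < ε → ∃ δ : ℝ, 0 < δ ∧ ∀ (ω : Ω) (p p' y y' : Ed d),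
      ‖p‖ ≤ R → ‖p'‖ ≤ R → ‖p - p'‖ < δ → ‖y - y'‖ < δ → |H p y ω - H p' y' ω| < ε)
    (hcoer : ∀ M : ℝ, ∃ R : ℝ, ∀ (ω : Ω) (p y : Ed d), R ≤ ‖p‖ → M ≤ H p y ω)
    (hqc : ∀ (ω : Ω) (p q y : Ed d), H ((1/2 : ℝ) • (p + q)) y ω ≤ max (H p y ω) (H q y ω))
    (Λ : ℝ → ℝ → ℝ)
    (hΛcont : Continuous fun m : ℝ × ℝ => Λ m.1 m.2)
    (hΛmono : ∀ a b a' b' : ℝ, a ≤ a' → b ≤ b' → Λ a b ≤ Λ a' b')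
    (hΛstrict : ∀ a b : ℝ, a ≠ b → Λ a b < max a b)
    (hsqc : ∀ (ω : Ω) (p q y : Ed d), H ((1/2 : ℝ) • (p + q)) y ω ≤ Λ (H p y ω) (H q y ω))
    (Hs : ℝ) (hHs : ∀ᵐ ω ∂P, HstarOm d H ω = Hs) :
    ∃ (Ω₁ : Set Ω), MeasurableSet Ω₁ ∧ P Ω₁ = 1 ∧
    ∃ mbar : ℝ → Ed d → ℝ,
      (∀ ω ∈ Ω₁, ∀ μ : ℝ, Hs < μ → ∀ x y : Ed d,
        Tendsto (fun t : ℝ => t⁻¹ * mMuOm d H μ (t • y) (t • x) ω) atTop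
          (𝓝 (mbar μ (y - x)))) ∧
      (∀ μ : ℝ, Hs < μ →
        ((∃ C : ℝ≥0, LipschitzWith C (mbar μ)) ∧
          (∀ s : ℝ, 0 ≤ s → ∀ y : Ed d, mbar μ (s • y) = s * mbar μ y) ∧
          ConvexOn ℝ Set.univ (mbar μ))) ∧
      (∀ y : Ed d, y ≠ 0 → StrictMonoOn (fun μ => mbar μ y) (Set.Ioi Hs)) := by
  have hHm : ∀ p y, Measurable (H p y) := fun p y =>
    hHmeas.comp (measurable_const.prodMk (measurable_const.prodMk measurable_id))
  -- coercivity bounds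
  have hRex : ∀ μ : ℝ, ∃ R : ℝ, 0 < R ∧ ∀ ω p y, H p y ω ≤ μ + 1 → ‖p‖ ≤ R := by
    intro μ
    obtain ⟨R, hR⟩ := hcoer (μ + 2)
    refine ⟨max R 1, lt_max_of_lt_right one_pos, fun ω p y hp => ?_⟩
    by_contra hcon
    rw [not_le] at hcon
    have := hR ω p y ((le_max_left _ _).trans hcon.le)
    linarith
  choose R hR0 hR using hRex
  have hErg : ∀ μ : ℝ, ErgF d τ (Ftr H μ) (R μ) := fun μ =>
    Ftr_ergF hHm hHcont hqc (hR0 μ).le (hR μ) (fun ε hε => by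
      obtain ⟨δ, hδ, hh⟩ := hreg_uc (R μ) (hR0 μ) ε hε
      exact ⟨δ, hδ, fun ω p y y' hp hy => hh ω p p y y' hp hp (by simpa using hδ) hy⟩)
      hΛcont hΛmono hΛstrict hsqc hτgrp hτzero hHstat
  choose c hc using fun μ => (hErg μ).main (hR0 μ).le P hτmp hτerg hτgrp hτzero
  have hsubex : ∀ ω, HstarOm d H ω = Hs → ∀ ν, Hs < ν → ∃ w, IsSub (fun p y => H p y ω) ν w := by
    intro ω hω ν hν
    refine exists_isSub (H := fun p y => H p y ω) (fun R hR => ?_) ?_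
    · obtain ⟨M, hM⟩ := hreg_bdd R hR
      exact ⟨M, fun p y => hM ω p y⟩
    · change HstarOm d H ω < ν
      rwa [hω]
  have hFm : ∀ ω, HstarOm d H ω = Hs → ∀ μ, Hs < μ → ∀ y x,
      Ftr H μ y x ω = mMu d (fun p y => H p y ω) μ y x := by
    intro ω hω μ hμ y x
    obtain ⟨ν, h1, h2⟩ := exists_between hμ
    have : ω ∈ goodG H μ := ⟨ν, h2, hsubex ω hω ν h1⟩
    simp only [Ftr, Set.indicator_of_mem this]
  have hlim : ∀ μ, Hs < μ → ∀ᵐ ω ∂P, ∀ x y : Ed d,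
      Tendsto (fun t : ℝ => t⁻¹ * mMu d (fun p y => H p y ω) μ (t • y) (t • x)) atTop
        (𝓝 (c μ (y - x))) := by
    intro μ hμ
    filter_upwards [hc μ, hHs] with ω h1 h2 x y
    simpa only [hFm ω h2 μ hμ] using h1 x y
  have hRle : ∀ ω μ p y, H p y ω ≤ μ → ‖p‖ ≤ R μ := fun ω μ p y hp => hR μ ω p y (by linarith)
  -- monotonicity of the limit
  have hcmono : ∀ μ μ', Hs < μ → μ ≤ μ' → ∀ v, c μ v ≤ c μ' v := by
    intro μ μ' hμ hμμ' v
    obtain ⟨ω, h1, h2, h3⟩ := ((hlim μ hμ).and ((hlim μ' (hμ.trans_le hμμ')).and hHs)).exists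
    have t1 := h1 0 v
    have t2 := h2 0 v
    rw [sub_zero] at t1 t2
    refine le_of_tendsto_of_tendsto t1 t2 ?_
    filter_upwards [eventually_gt_atTop (0:ℝ)] with t ht
    exact mul_le_mul_of_nonneg_left (mMu_mono (hRle ω μ') hμμ' (hsubex ω h3 μ hμ) _ _)
      (inv_nonneg.2 ht.le)
  have hae : ∀ᵐ ω ∂P, HstarOm d H ω = Hs ∧ ∀ q : ℚ, Hs < q → ∀ x y : Ed d,
      Tendsto (fun t : ℝ => t⁻¹ * mMu d (fun p y => H p y ω) q (t • y) (t • x)) atTop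
        (𝓝 (c q (y - x))) := by
    refine hHs.and (ae_all_iff.2 fun q => ?_)
    by_cases hq : Hs < (q : ℝ)
    · filter_upwards [hlim q hq] with ω hω _ using hω
    · exact Eventually.of_forall fun ω hq' => absurd hq' hq
  obtain ⟨N, hNsub, hNm, hN0⟩ := exists_measurable_superset_of_null (ae_iff.1 hae)
  refine ⟨Nᶜ, hNm.compl, (prob_compl_eq_one_iff hNm).2 hN0, c, ?_, ?_, ?_⟩
  · intro ω hωN μ hμ x y
    obtain ⟨hω, hrat⟩ : HstarOm d H ω = Hs ∧ ∀ q : ℚ, Hs < q → ∀ x y : Ed d,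
        Tendsto (fun t : ℝ => t⁻¹ * mMu d (fun p y => H p y ω) q (t • y) (t • x)) atTop
        (𝓝 (c q (y - x))) := by
      by_contra hcon
      exact hωN (hNsub hcon)
    change Tendsto (fun t : ℝ => t⁻¹ * mMu d (fun p y => H p y ω) μ (t • y) (t • x)) atTop
        (𝓝 (c μ (y - x)))
    rw [Metric.tendsto_nhds]
    intro ε₀ hε₀
    set ε := ε₀ / (2 * (‖y - x‖ + 1)) with hε
    have hεpos : 0 < ε := by positivity
    have hεsum : ε * ‖y - x‖ + ε = ε₀ / 2 := by rw [hε]; field_simp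
    obtain ⟨ν, hν1, hν2⟩ := exists_between hμ
    obtain ⟨μ₁, μ₂, h1, h2, h3, h3', h4⟩ :=
      mMu_cont (d := d) hΛcont hΛmono hΛstrict ν μ (R μ) ε hεpos hν2
    have h5 := h4 _ (hsqc ω) (hR μ ω) (hsubex ω hω ν hν1)
    obtain ⟨q₁, hq1, hq1'⟩ := exists_rat_btwn h2
    obtain ⟨q₂, hq2, hq2'⟩ := exists_rat_btwn h3
    have hHq1 : Hs < (q₁ : ℝ) := by linarith
    have hHq2 : Hs < (q₂ : ℝ) := by linarith
    have T1 := hrat q₁ hHq1 x y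
    have T2 := hrat q₂ hHq2 x y
    have hcomp : ∀ t : ℝ, 0 < t →
        t⁻¹ * mMu d (fun p y => H p y ω) q₂ (t • y) (t • x) ≤
        t⁻¹ * mMu d (fun p y => H p y ω) q₁ (t • y) (t • x) + ε * ‖y - x‖ := by
      intro t ht
      have a1 := mMu_mono (hRle ω μ₂) hq2'.le (hsubex ω hω q₂ hHq2) (t • y) (t • x)
      have a2 := mMu_mono (hRle ω q₁) hq1.le (hsubex ω hω μ₁ (by linarith)) (t • y) (t • x)
      have a3 := h5 (t • y) (t • x)
      rw [← smul_sub, norm_smul, Real.norm_of_nonneg ht.le] at a3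
      have a4 : t⁻¹ * mMu d (fun p y => H p y ω) q₂ (t • y) (t • x) ≤
        t⁻¹ * (mMu d (fun p y => H p y ω) q₁ (t • y) (t • x) + ε * (t * ‖y - x‖)) :=
        mul_le_mul_of_nonneg_left (by linarith) (inv_nonneg.2 ht.le)
      have a5 : t⁻¹ * (ε * (t * ‖y - x‖)) = ε * ‖y - x‖ := by field_simp
      rw [mul_add, a5] at a4
      exact a4
    have hc12 : c q₂ (y - x) ≤ c q₁ (y - x) + ε * ‖y - x‖ := by
      refine le_of_tendsto_of_tendsto T2 (T1.add_const _) ?_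
      filter_upwards [eventually_gt_atTop (0:ℝ)] with t ht using hcomp t ht
    have m1 := hcmono q₁ μ hHq1 hq1'.le (y - x)
    have m2 := hcmono μ q₂ hμ hq2.le (y - x)
    filter_upwards [Metric.tendsto_nhds.1 T1 ε hεpos, Metric.tendsto_nhds.1 T2 ε hεpos,
      eventually_gt_atTop (0:ℝ)] with t e1 e2 ht
    have b1 : t⁻¹ * mMu d (fun p y => H p y ω) q₁ (t • y) (t • x) ≤
        t⁻¹ * mMu d (fun p y => H p y ω) μ (t • y) (t • x) :=
      mul_le_mul_of_nonneg_left (mMu_mono (hRle ω μ) hq1'.le (hsubex ω hω q₁ hHq1) _ _)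
        (inv_nonneg.2 ht.le)
    have b2 : t⁻¹ * mMu d (fun p y => H p y ω) μ (t • y) (t • x) ≤
        t⁻¹ * mMu d (fun p y => H p y ω) q₂ (t • y) (t • x) :=
      mul_le_mul_of_nonneg_left (mMu_mono (hRle ω q₂) hq2.le (hsubex ω hω μ hμ) _ _)
        (inv_nonneg.2 ht.le)
    rw [Real.dist_eq, abs_lt] at e1 e2 ⊢
    constructor <;> linarith [e1.1, e2.2]
  · intro μ hμ
    obtain ⟨ω, h1⟩ := (hc μ).exists
    exact (hErg μ).props (hR0 μ).le ω (c μ) h1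
  · intro y hy ν hν μ hμ hνμ
    have hν' : Hs < ν := hν
    have hμ' : Hs < μ := hμ
    change c ν y < c μ y
    obtain ⟨δ, hδ, hδ'⟩ := hreg_uc (R ν + 1) (by linarith [hR0 ν]) (μ - ν) (by linarith)
    set ε := min (δ / 2) 1 with hε
    have hεpos : 0 < ε := lt_min (by linarith) one_pos
    have hε1 : ε ≤ 1 := min_le_right _ _
    have hε2 : ε ≤ δ / 2 := min_le_left _ _
    obtain ⟨ω, h1, h2, h3⟩ := ((hlim ν hν').and ((hlim μ hμ').and hHs)).exists
    have t1 := h1 0 y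
    have t2 := h2 0 y
    rw [sub_zero] at t1 t2
    have key : c ν y + ε * ‖y‖ ≤ c μ y := by
      refine le_of_tendsto_of_tendsto (t1.add_const _) t2 ?_
      filter_upwards [eventually_gt_atTop (0:ℝ)] with t ht
      have a1 := mMu_tilt (h := fun p y => H p y ω) (μ := ν) (ν := μ) hεpos.le (hRle ω μ) (by
        intro p e y he hp
        have hpR := hRle ω ν p y hp
        have := hδ' ω p (p + e) y y (by linarith)
          ((norm_add_le p e).trans (by linarith)) (by
            rw [sub_add_cancel_left, norm_neg]; linarith) (by simpa using hδ)
        have := (abs_lt.1 this).1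
        linarith) (hsubex ω h3 ν hν') (t • y) (t • 0)
      rw [smul_zero, sub_zero, norm_smul, Real.norm_of_nonneg ht.le] at a1
      have a4 := mul_le_mul_of_nonneg_left a1 (inv_nonneg.2 ht.le)
      have a5 : t⁻¹ * (ε * (t * ‖y‖)) = ε * ‖y‖ := by field_simp
      rw [mul_add, a5] at a4
      rw [smul_zero]
      exact a4
    have : 0 < ε * ‖y‖ := mul_pos hεpos (norm_pos_iff.2 hy)
    linarith
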